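/- arXiv:2409.01328 — 6 statements merged into one kernel-verified Lean document; each statement's English description precedes it below -/
import Mathlib

section
/- Let U ⊆ ℝ² be open and a, b : U → ℝ be smooth with b nowhere zero on U. Define the 2×2 matrix of functions N by N¹₁ = a, N¹₂ = −b, N²₁ = b, N²₂ = a. Then the coordinate Nijenhuis torsion of N vanishes identically on U, i.e. T^λ_{μν} = 0 for all λ, μ, ν ∈ {1,2}, if and only if a and b satisfy the Cauchy–Riemann equations ∂₁a = ∂₂b and ∂₂a = −∂₁b on U. -/
open scoped BigOperators

/-- Partial derivative of a real-valued function on `ℝⁿ` in the `μ`-th coordinate direction. -/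
noncomputable def pd {n : ℕ} (μ : Fin n) (f : (Fin n → ℝ) → ℝ) (x : Fin n → ℝ) : ℝ :=
  fderiv ℝ f x (Pi.single μ 1)

theorem pd_neg {n : ℕ} (μ : Fin n) (f : (Fin n → ℝ) → ℝ) (x : Fin n → ℝ) :
    pd μ (-f) x = -pd μ f x := by
  simp [pd, fderiv_neg]

/-- for `N = ((a, −b), (b, a))` with `b` nowhere zero, the coordinate Nijenhuis
torsion vanishes on `U` iff `a, b` satisfy the Cauchy–Riemann equations on `U`. -/
theorem statement2 (U : Set (Fin 2 → ℝ)) (hU : IsOpen U)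
    (a b : (Fin 2 → ℝ) → ℝ)
    (ha : ContDiffOn ℝ (⊤ : ℕ∞) a U) (hb : ContDiffOn ℝ (⊤ : ℕ∞) b U)
    (hb0 : ∀ x ∈ U, b x ≠ 0)
    (N : Fin 2 → Fin 2 → (Fin 2 → ℝ) → ℝ)
    (hN : N = ![![a, -b], ![b, a]]) :
    (∀ x ∈ U, ∀ l μ ν : Fin 2,
        ∑ κ, (N κ μ x * pd κ (N l ν) x - N κ ν x * pd κ (N l μ) x
          + N l κ x * (pd ν (N κ μ) x - pd μ (N κ ν) x)) = 0)
      ↔ (∀ x ∈ U, pd 0 a x = pd 1 b x ∧ pd 1 a x = -(pd 0 b x)) := by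
  subst hN
  refine forall₂_congr fun x hx => ?_
  have hbx := hb0 x hx
  simp only [Fin.forall_fin_two, Fin.sum_univ_two, Matrix.cons_val_zero, Matrix.cons_val_one,
    pd_neg, Pi.neg_apply]
  constructor
  · rintro ⟨⟨⟨-, h₀⟩, -⟩, ⟨⟨-, h₁⟩, -⟩⟩
    constructor
    · apply mul_left_cancel₀ hbx
      linarith
    · apply mul_left_cancel₀ hbx
      linarith
  · rintro ⟨h₀, h₁⟩
    rw [h₀, h₁]
    refine ⟨⟨⟨?_, ?_⟩, ?_, ?_⟩, ⟨?_, ?_⟩, ?_, ?_⟩ <;> ring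
end

section
/- Let U ⊆ ℝ² be open and a, b : U → ℝ smooth functions satisfying the Cauchy–Riemann equations ∂₁a = ∂₂b and ∂₂a = −∂₁b. Define N¹₁ = a, N¹₂ = −b, N²₁ = b, N²₂ = a. Let φ : U → M_m(ℂ) be a twice continuously differentiable matrix-valued function. Then φ satisfies the equation Σ_κ ( N^κ_μ ∂_ν ∂_κ φ − N^κ_ν ∂_μ ∂_κ φ ) + Σ_κ ( ∂_ν N^κ_μ − ∂_μ N^κ_ν ) ∂_κ φ = [ ∂_μ φ , ∂_ν φ ] for all μ, ν ∈ {1,2} if and only if φ satisfies b·(∂₁∂₁φ + ∂₂∂₂φ) = [ ∂₁φ , ∂₂φ ]. -/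
open scoped BigOperators

/-- Entrywise partial derivative of a matrix-valued function on `ℝⁿ`. -/
noncomputable def pdM {n m r : ℕ} (μ : Fin n) (f : (Fin n → ℝ) → Matrix (Fin m) (Fin r) ℂ)
    (x : Fin n → ℝ) : Matrix (Fin m) (Fin r) ℂ :=
  Matrix.of fun i j => fderiv ℝ (fun y => f y i j) x (Pi.single μ 1)

/-- Mixed partial derivatives of an entrywise C² matrix-valued function commute. -/
theorem pdM_comm {n m r : ℕ} {φ : (Fin n → ℝ) → Matrix (Fin m) (Fin r) ℂ} {x : Fin n → ℝ}
    (hφ : ∀ i j, ContDiffAt ℝ 2 (fun y => φ y i j) x) (μ ν : Fin n) :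
    pdM μ (pdM ν φ) x = pdM ν (pdM μ φ) x := by
  ext i j
  have hd : DifferentiableAt ℝ (fderiv ℝ fun y => φ y i j) x :=
    ((hφ i j).fderiv_right (m := 1) (by norm_num)).differentiableAt (by norm_num)
  have hsymm : IsSymmSndFDerivAt ℝ (fun y => φ y i j) x :=
    (hφ i j).isSymmSndFDerivAt (by simp)
  have key (v w : Fin n → ℝ) :
      fderiv ℝ (fun y => fderiv ℝ (fun z => φ z i j) y v) x w
        = fderiv ℝ (fderiv ℝ fun z => φ z i j) x w v := by
    rw [fderiv_clm_apply hd (differentiableAt_const v)]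
    simp
  simp only [pdM, Matrix.of_apply, key]
  exact hsymm _ _

/-- for `N = ((a, −b), (b, a))` with `a, b` satisfying the Cauchy–Riemann
equations, a C² map `φ : U → M_m(ℂ)` satisfies the general coordinate equation
iff it satisfies `b·Δφ = [∂₁φ, ∂₂φ]`. -/
theorem statement3 {m : ℕ} (U : Set (Fin 2 → ℝ)) (hU : IsOpen U)
    (a b : (Fin 2 → ℝ) → ℝ)
    (ha : ContDiffOn ℝ (⊤ : ℕ∞) a U) (hb : ContDiffOn ℝ (⊤ : ℕ∞) b U)
    (hCR1 : ∀ x ∈ U, pd 0 a x = pd 1 b x) (hCR2 : ∀ x ∈ U, pd 1 a x = -(pd 0 b x))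
    (N : Fin 2 → Fin 2 → (Fin 2 → ℝ) → ℝ)
    (hN : N = ![![a, -b], ![b, a]])
    (φ : (Fin 2 → ℝ) → Matrix (Fin m) (Fin m) ℂ)
    (hφ : ∀ i j, ContDiffOn ℝ 2 (fun y => φ y i j) U) :
    (∀ x ∈ U, ∀ μ ν : Fin 2,
        (∑ κ, (N κ μ x • pdM ν (pdM κ φ) x - N κ ν x • pdM μ (pdM κ φ) x))
          + (∑ κ, (pd ν (N κ μ) x - pd μ (N κ ν) x) • pdM κ φ x)
        = pdM μ φ x * pdM ν φ x - pdM ν φ x * pdM μ φ x)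
      ↔ (∀ x ∈ U,
          b x • (pdM 0 (pdM 0 φ) x + pdM 1 (pdM 1 φ) x)
            = pdM 0 φ x * pdM 1 φ x - pdM 1 φ x * pdM 0 φ x) := by
  have hcomm : ∀ x ∈ U, pdM 1 (pdM 0 φ) x = pdM 0 (pdM 1 φ) x := fun x hx =>
    pdM_comm (fun i j => (hφ i j).contDiffAt (hU.mem_nhds hx)) 1 0
  have h01 : ∀ x ∈ U,
      (∑ κ, (N κ 0 x • pdM 1 (pdM κ φ) x - N κ 1 x • pdM 0 (pdM κ φ) x))
          + (∑ κ, (pd 1 (N κ 0) x - pd 0 (N κ 1) x) • pdM κ φ x)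
        = b x • (pdM 0 (pdM 0 φ) x + pdM 1 (pdM 1 φ) x) := by
    intro x hx
    simp only [hN, Fin.sum_univ_two, Matrix.cons_val_zero, Matrix.cons_val_one, pd_neg,
      Pi.neg_apply, hCR1 x hx, hCR2 x hx, hcomm x hx]
    module
  have h10 : ∀ x ∈ U,
      (∑ κ, (N κ 1 x • pdM 0 (pdM κ φ) x - N κ 0 x • pdM 1 (pdM κ φ) x))
          + (∑ κ, (pd 0 (N κ 1) x - pd 1 (N κ 0) x) • pdM κ φ x)
        = -(b x • (pdM 0 (pdM 0 φ) x + pdM 1 (pdM 1 φ) x)) := by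
    intro x hx
    rw [← h01 x hx]
    simp only [Fin.sum_univ_two]
    module
  constructor
  · intro h x hx
    rw [← h01 x hx, h x hx 0 1]
  · intro h x hx
    rw [Fin.forall_fin_two, Fin.forall_fin_two, Fin.forall_fin_two]
    refine ⟨⟨by simp, (h01 x hx).trans (h x hx)⟩, ?_, by simp⟩
    rw [h10 x hx, h x hx, neg_sub]
end

section
/- Let U ⊆ ℝⁿ be open and N₁^μ_ν, N₂^μ_ν smooth real functions on U with all coordinate Frölicher–Nijenhuis brackets vanishing, i.e. for (i,j) ∈ {(1,1),(1,2),(2,2)} and all μ,ν,λ: Σ_κ [ N_i^κ_μ ∂_κ N_j^λ_ν − N_i^κ_ν ∂_κ N_j^λ_μ + N_j^κ_μ ∂_κ N_i^λ_ν − N_j^κ_ν ∂_κ N_i^λ_μ + N_i^λ_κ (∂_ν N_j^κ_μ − ∂_μ N_j^κ_ν) + N_j^λ_κ (∂_ν N_i^κ_μ − ∂_μ N_i^κ_ν) ] = 0. Let φ : U → M_m(ℂ) be a smooth solution of the nonlinear PDE system Σ_{κ,λ} [ N₂^κ_μ ∂_κ( N₁^λ_ν ∂_λ φ ) − N₂^κ_ν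 ∂_κ( N₁^λ_μ ∂_λ φ ) ] + Σ_{κ,λ} N₁^κ_λ ( ∂_ν N₂^λ_μ − ∂_μ N₂^λ_ν ) ∂_κ φ = Σ_{κ,λ} N₁^κ_μ N₁^λ_ν [ ∂_κ φ , ∂_λ φ ] (all μ,ν), and set A_μ := Σ_κ N₁^κ_μ ∂_κ φ. Suppose P, Q, κ_μ, λ_μ, θ, η, Ω satisfy all the hypotheses of the coordinate binary Darboux transformation theorem with these A_μ (the equations for P, Q, κ_μ, λ_μ, the two linear systems for θ and η, the Sylvester equation P Ω − Ω Q = η θ, and the differential equation for Ω). Then on any open subset of U where Ω is invertible, φ' := φ − θ Ω^{-1} η is again a solution of the same nonlinear PDE system. -/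
open scoped BigOperators

/-- Coordinate Frölicher–Nijenhuis bracket of two matrices of functions. -/
noncomputable def FNb {n : ℕ} (N M : Fin n → Fin n → (Fin n → ℝ) → ℝ)
    (l μ ν : Fin n) (x : Fin n → ℝ) : ℝ :=
  ∑ κ, (N κ μ x * pd κ (M l ν) x - N κ ν x * pd κ (M l μ) x
      + M κ μ x * pd κ (N l ν) x - M κ ν x * pd κ (N l μ) x
      + N l κ x * (pd ν (M κ μ) x - pd μ (M κ ν) x)
      + M l κ x * (pd ν (N κ μ) x - pd μ (N κ ν) x))

/-- The nonlinear PDE system (φ-version) associated with `N₁, N₂`: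
`Σ_{κ,λ} [N₂^κ_μ ∂_κ(N₁^λ_ν ∂_λφ) − N₂^κ_ν ∂_κ(N₁^λ_μ ∂_λφ)]
 + Σ_{κ,λ} N₁^κ_λ (∂_ν N₂^λ_μ − ∂_μ N₂^λ_ν) ∂_κφ = Σ_{κ,λ} N₁^κ_μ N₁^λ_ν [∂_κφ, ∂_λφ]`. -/
def phiPDE {n m : ℕ} (N₁ N₂ : Fin n → Fin n → (Fin n → ℝ) → ℝ)
    (φ : (Fin n → ℝ) → Matrix (Fin m) (Fin m) ℂ) (μ ν : Fin n) (x : Fin n → ℝ) : Prop :=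
  (∑ κ, ∑ l, (N₂ κ μ x • pdM κ (fun y => N₁ l ν y • pdM l φ y) x
            - N₂ κ ν x • pdM κ (fun y => N₁ l μ y • pdM l φ y) x))
    + (∑ κ, ∑ l, (N₁ κ l x * (pd ν (N₂ l μ) x - pd μ (N₂ l ν) x)) • pdM κ φ x)
  = ∑ κ, ∑ l, (N₁ κ μ x * N₁ l ν x) •
      (pdM κ φ x * pdM l φ x - pdM l φ x * pdM κ φ x)

open scoped BigOperators ContDiff

namespace BidifferentialCalculus

variable {n m r s : ℕ}

/-- All matrix entries are differentiable at `x`. -/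
def EntriesDiffAt (f : (Fin n → ℝ) → Matrix (Fin m) (Fin r) ℂ) (x : Fin n → ℝ) : Prop :=
  ∀ i j, DifferentiableAt ℝ (fun y => f y i j) x

/-- All matrix entries are smooth on `V`. -/
def EntriesSmoothOn (f : (Fin n → ℝ) → Matrix (Fin m) (Fin r) ℂ) (V : Set (Fin n → ℝ)) : Prop :=
  ∀ i j, ContDiffOn ℝ ∞ (fun y => f y i j) V

/-- The differential of a matrix of functions, twisted by the tensor field `N`. -/
noncomputable def twistedD (N : Fin n → Fin n → (Fin n → ℝ) → ℝ)
    (f : (Fin n → ℝ) → Matrix (Fin m) (Fin r) ℂ) (μ : Fin n) (x : Fin n → ℝ) :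
    Matrix (Fin m) (Fin r) ℂ :=
  ∑ κ, N κ μ x • pdM κ f x

/-- The exterior derivative of a matrix of 1-forms, twisted by the tensor field `N`. -/
noncomputable def twistedD₁ (N : Fin n → Fin n → (Fin n → ℝ) → ℝ)
    (α : Fin n → (Fin n → ℝ) → Matrix (Fin m) (Fin r) ℂ) (μ ν : Fin n) (x : Fin n → ℝ) :
    Matrix (Fin m) (Fin r) ℂ :=
  ∑ κ, (N κ μ x • pdM κ (α ν) x - N κ ν x • pdM κ (α μ) x
    + (pd ν (N κ μ) x - pd μ (N κ ν) x) • α κ x)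

section PartialDerivatives

variable {x : Fin n → ℝ}

lemma EntriesDiffAt.mul {f : (Fin n → ℝ) → Matrix (Fin m) (Fin r) ℂ}
    {g : (Fin n → ℝ) → Matrix (Fin r) (Fin s) ℂ}
    (hf : EntriesDiffAt f x) (hg : EntriesDiffAt g x) :
    EntriesDiffAt (fun y => f y * g y) x := by
  intro i j
  simp only [Matrix.mul_apply]
  exact DifferentiableAt.fun_sum fun k _ => (hf i k).mul (hg k j)

lemma EntriesDiffAt.add {f g : (Fin n → ℝ) → Matrix (Fin m) (Fin r) ℂ}
    (hf : EntriesDiffAt f x) (hg : EntriesDiffAt g x) :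
    EntriesDiffAt (fun y => f y + g y) x :=
  fun i j => (hf i j).add (hg i j)

lemma EntriesDiffAt.sub {f g : (Fin n → ℝ) → Matrix (Fin m) (Fin r) ℂ}
    (hf : EntriesDiffAt f x) (hg : EntriesDiffAt g x) :
    EntriesDiffAt (fun y => f y - g y) x :=
  fun i j => (hf i j).sub (hg i j)

lemma EntriesDiffAt.smul {c : (Fin n → ℝ) → ℝ} {f : (Fin n → ℝ) → Matrix (Fin m) (Fin r) ℂ}
    (hc : DifferentiableAt ℝ c x) (hf : EntriesDiffAt f x) :
    EntriesDiffAt (fun y => c y • f y) x :=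
  fun i j => hc.smul (hf i j)

lemma pdM_mul {f : (Fin n → ℝ) → Matrix (Fin m) (Fin r) ℂ}
    {g : (Fin n → ℝ) → Matrix (Fin r) (Fin s) ℂ}
    (hf : EntriesDiffAt f x) (hg : EntriesDiffAt g x) (μ : Fin n) :
    pdM μ (fun y => f y * g y) x = pdM μ f x * g x + f x * pdM μ g x := by
  ext i j
  simp only [pdM, Matrix.mul_apply, Matrix.of_apply, Matrix.add_apply]
  rw [fderiv_fun_sum fun k _ => (hf i k).fun_mul (hg k j), ← Finset.sum_add_distrib,
    sum_apply]
  refine Finset.sum_congr rfl fun k _ => ?_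
  rw [fderiv_fun_mul (hf i k) (hg k j)]
  simp only [add_apply, smul_apply, smul_eq_mul]
  ring

lemma pdM_add {f g : (Fin n → ℝ) → Matrix (Fin m) (Fin r) ℂ}
    (hf : EntriesDiffAt f x) (hg : EntriesDiffAt g x) (μ : Fin n) :
    pdM μ (fun y => f y + g y) x = pdM μ f x + pdM μ g x := by
  ext i j
  simp [pdM, fderiv_fun_add (hf i j) (hg i j)]

lemma pdM_sub {f g : (Fin n → ℝ) → Matrix (Fin m) (Fin r) ℂ}
    (hf : EntriesDiffAt f x) (hg : EntriesDiffAt g x) (μ : Fin n) :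
    pdM μ (fun y => f y - g y) x = pdM μ f x - pdM μ g x := by
  ext i j
  simp [pdM, fderiv_fun_sub (hf i j) (hg i j)]

lemma pdM_smul {c : (Fin n → ℝ) → ℝ} {f : (Fin n → ℝ) → Matrix (Fin m) (Fin r) ℂ}
    (hc : DifferentiableAt ℝ c x) (hf : EntriesDiffAt f x) (μ : Fin n) :
    pdM μ (fun y => c y • f y) x = pd μ c x • f x + c x • pdM μ f x := by
  ext i j
  simp only [pdM, pd, Matrix.smul_apply, Matrix.of_apply, Matrix.add_apply]
  rw [fderiv_fun_smul hc (hf i j)]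
  simp [add_comm]

lemma pdM_sum {ι : Type*} {t : Finset ι} {f : ι → (Fin n → ℝ) → Matrix (Fin m) (Fin r) ℂ}
    (hf : ∀ k ∈ t, EntriesDiffAt (f k) x) (μ : Fin n) :
    pdM μ (fun y => ∑ k ∈ t, f k y) x = ∑ k ∈ t, pdM μ (f k) x := by
  ext i j
  simp only [pdM, Matrix.sum_apply, Matrix.of_apply]
  rw [fderiv_fun_sum fun k hk => hf k hk i j, sum_apply]

lemma pdM_congr {f g : (Fin n → ℝ) → Matrix (Fin m) (Fin r) ℂ} (h : f =ᶠ[nhds x] g)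
    (μ : Fin n) : pdM μ f x = pdM μ g x := by
  ext i j
  simp only [pdM, Matrix.of_apply]
  rw [Filter.EventuallyEq.fderiv_eq (h.mono fun y hy => congrFun (congrFun hy i) j)]

end PartialDerivatives

section Smoothness

variable {V : Set (Fin n → ℝ)}

lemma EntriesSmoothOn.entriesDiffAt {f : (Fin n → ℝ) → Matrix (Fin m) (Fin r) ℂ}
    (hf : EntriesSmoothOn f V) (hV : IsOpen V) {x : Fin n → ℝ} (hx : x ∈ V) :
    EntriesDiffAt f x :=
  fun i j => ((hf i j).contDiffAt (hV.mem_nhds hx)).differentiableAt (by simp)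

lemma EntriesSmoothOn.mul {f : (Fin n → ℝ) → Matrix (Fin m) (Fin r) ℂ}
    {g : (Fin n → ℝ) → Matrix (Fin r) (Fin s) ℂ}
    (hf : EntriesSmoothOn f V) (hg : EntriesSmoothOn g V) :
    EntriesSmoothOn (fun y => f y * g y) V := by
  intro i j
  simp only [Matrix.mul_apply]
  exact ContDiffOn.sum fun k _ => (hf i k).mul (hg k j)

lemma EntriesSmoothOn.sub {f g : (Fin n → ℝ) → Matrix (Fin m) (Fin r) ℂ}
    (hf : EntriesSmoothOn f V) (hg : EntriesSmoothOn g V) :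
    EntriesSmoothOn (fun y => f y - g y) V :=
  fun i j => (hf i j).sub (hg i j)

lemma EntriesSmoothOn.pdM {f : (Fin n → ℝ) → Matrix (Fin m) (Fin r) ℂ}
    (hf : EntriesSmoothOn f V) (hV : IsOpen V) (μ : Fin n) :
    EntriesSmoothOn (pdM μ f) V := by
  intro i j
  simp only [_root_.pdM, Matrix.of_apply]
  exact ((hf i j).fderiv_of_isOpen hV (m := ∞) le_rfl).clm_apply contDiffOn_const

lemma EntriesSmoothOn.twistedD {N : Fin n → Fin n → (Fin n → ℝ) → ℝ}
    (hN : ∀ μ ν, ContDiffOn ℝ ∞ (N μ ν) V)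
    {f : (Fin n → ℝ) → Matrix (Fin m) (Fin r) ℂ}
    (hf : EntriesSmoothOn f V) (hV : IsOpen V) (μ : Fin n) :
    EntriesSmoothOn (twistedD N f μ) V := by
  intro i j
  simp only [BidifferentialCalculus.twistedD, Matrix.sum_apply, Matrix.smul_apply]
  exact ContDiffOn.sum fun k _ => (hN k μ).smul (hf.pdM hV k i j)

lemma EntriesSmoothOn.det {f : (Fin n → ℝ) → Matrix (Fin r) (Fin r) ℂ}
    (hf : EntriesSmoothOn f V) : ContDiffOn ℝ ∞ (fun y => (f y).det) V := by
  simp only [Matrix.det_apply]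
  exact ContDiffOn.sum fun σ _ => (contDiffOn_prod fun i _ => hf (σ i) i).const_smul _

lemma EntriesSmoothOn.inv {f : (Fin n → ℝ) → Matrix (Fin r) (Fin r) ℂ}
    (hf : EntriesSmoothOn f V) (hu : ∀ x ∈ V, IsUnit (f x)) :
    EntriesSmoothOn (fun y => (f y)⁻¹) V := by
  intro i j
  simp only [Matrix.inv_def, Matrix.smul_apply, Matrix.adjugate_apply, Ring.inverse_eq_inv',
    smul_eq_mul]
  refine (hf.det.inv fun x hx => ?_).mul (EntriesSmoothOn.det fun k l => ?_)
  · exact ((Matrix.isUnit_iff_isUnit_det _).1 (hu x hx)).ne_zero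
  · simp only [Matrix.updateRow_apply]
    split_ifs
    · exact contDiffOn_const
    · exact hf k l

lemma pdM_comm {f : (Fin n → ℝ) → Matrix (Fin m) (Fin r) ℂ}
    (hf : EntriesSmoothOn f V) (hV : IsOpen V) {x : Fin n → ℝ} (hx : x ∈ V) (μ ν : Fin n) :
    pdM μ (pdM ν f) x = pdM ν (pdM μ f) x := by
  ext i j
  have hc : ContDiffAt ℝ ∞ (fun y => f y i j) x := (hf i j).contDiffAt (hV.mem_nhds hx)
  have hd : DifferentiableAt ℝ (fderiv ℝ fun y => f y i j) x :=
    (hc.fderiv_right (m := ∞) le_rfl).differentiableAt (by simp)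
  have hs : IsSymmSndFDerivAt ℝ (fun y => f y i j) x := hc.isSymmSndFDerivAt (by
    simp only [minSmoothness_of_isRCLikeNormedField]
    exact WithTop.coe_le_coe.2 (le_top : (2 : ℕ∞) ≤ ⊤))
  simp only [pdM, Matrix.of_apply]
  rw [fderiv_clm_apply hd (differentiableAt_const _),
    fderiv_clm_apply hd (differentiableAt_const _)]
  simpa using hs (Pi.single μ 1) (Pi.single ν 1)

end Smoothness

section TwistedDifferentials

variable {N M : Fin n → Fin n → (Fin n → ℝ) → ℝ} {x : Fin n → ℝ}

lemma twistedD_mul {f : (Fin n → ℝ) → Matrix (Fin m) (Fin r) ℂ}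
    {g : (Fin n → ℝ) → Matrix (Fin r) (Fin s) ℂ}
    (hf : EntriesDiffAt f x) (hg : EntriesDiffAt g x) (μ : Fin n) :
    twistedD N (fun y => f y * g y) μ x = twistedD N f μ x * g x + f x * twistedD N g μ x := by
  simp only [twistedD, pdM_mul hf hg, smul_add, Finset.sum_add_distrib,
    Matrix.sum_mul, Matrix.mul_sum,
    Matrix.smul_mul, Matrix.mul_smul]

lemma twistedD_sub {f g : (Fin n → ℝ) → Matrix (Fin m) (Fin r) ℂ}
    (hf : EntriesDiffAt f x) (hg : EntriesDiffAt g x) (μ : Fin n) :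
    twistedD N (fun y => f y - g y) μ x = twistedD N f μ x - twistedD N g μ x := by
  simp only [twistedD, pdM_sub hf hg, smul_sub, Finset.sum_sub_distrib]

lemma twistedD_congr {f g : (Fin n → ℝ) → Matrix (Fin m) (Fin r) ℂ} (h : f =ᶠ[nhds x] g)
    (μ : Fin n) : twistedD N f μ x = twistedD N g μ x := by
  simp only [twistedD, pdM_congr h]

lemma twistedD₁_congr {α τ : Fin n → (Fin n → ℝ) → Matrix (Fin m) (Fin r) ℂ}
    (h : ∀ μ, α μ =ᶠ[nhds x] τ μ) (μ ν : Fin n) :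
    twistedD₁ N α μ ν x = twistedD₁ N τ μ ν x := by
  simp only [twistedD₁, pdM_congr (h _), (h _).eq_of_nhds]

lemma twistedD₁_add {α τ : Fin n → (Fin n → ℝ) → Matrix (Fin m) (Fin r) ℂ}
    (hα : ∀ μ, EntriesDiffAt (α μ) x) (hτ : ∀ μ, EntriesDiffAt (τ μ) x) (μ ν : Fin n) :
    twistedD₁ N (fun μ y => α μ y + τ μ y) μ ν x
      = twistedD₁ N α μ ν x + twistedD₁ N τ μ ν x := by
  simp only [twistedD₁, pdM_add (hα _) (hτ _), ← Finset.sum_add_distrib, smul_add]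
  exact Finset.sum_congr rfl fun κ _ => by abel

lemma twistedD₁_sub {α τ : Fin n → (Fin n → ℝ) → Matrix (Fin m) (Fin r) ℂ}
    (hα : ∀ μ, EntriesDiffAt (α μ) x) (hτ : ∀ μ, EntriesDiffAt (τ μ) x) (μ ν : Fin n) :
    twistedD₁ N (fun μ y => α μ y - τ μ y) μ ν x
      = twistedD₁ N α μ ν x - twistedD₁ N τ μ ν x := by
  simp only [twistedD₁, pdM_sub (hα _) (hτ _), ← Finset.sum_sub_distrib, smul_sub]
  exact Finset.sum_congr rfl fun κ _ => by abel

/-- Leibniz rule for a 1-form times a function. -/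
lemma twistedD₁_mul_right {α : Fin n → (Fin n → ℝ) → Matrix (Fin m) (Fin r) ℂ}
    {f : (Fin n → ℝ) → Matrix (Fin r) (Fin s) ℂ}
    (hα : ∀ μ, EntriesDiffAt (α μ) x) (hf : EntriesDiffAt f x) (μ ν : Fin n) :
    twistedD₁ N (fun μ y => α μ y * f y) μ ν x
      = twistedD₁ N α μ ν x * f x
        - (α μ x * twistedD N f ν x - α ν x * twistedD N f μ x) := by
  simp only [twistedD₁, twistedD, pdM_mul (hα _) hf, Matrix.sum_mul, Matrix.mul_sum,
    ← Finset.sum_sub_distrib]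
  refine Finset.sum_congr rfl fun κ _ => ?_
  simp only [Matrix.add_mul, Matrix.sub_mul, Matrix.smul_mul, Matrix.mul_smul, smul_add]
  abel

/-- Leibniz rule for a function times a 1-form. -/
lemma twistedD₁_mul_left {α : Fin n → (Fin n → ℝ) → Matrix (Fin r) (Fin s) ℂ}
    {f : (Fin n → ℝ) → Matrix (Fin m) (Fin r) ℂ}
    (hf : EntriesDiffAt f x) (hα : ∀ μ, EntriesDiffAt (α μ) x) (μ ν : Fin n) :
    twistedD₁ N (fun μ y => f y * α μ y) μ ν x
      = f x * twistedD₁ N α μ ν x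
        + (twistedD N f μ x * α ν x - twistedD N f ν x * α μ x) := by
  simp only [twistedD₁, twistedD, pdM_mul hf (hα _), Matrix.sum_mul, Matrix.mul_sum,
    ← Finset.sum_sub_distrib, ← Finset.sum_add_distrib]
  refine Finset.sum_congr rfl fun κ _ => ?_
  simp only [Matrix.mul_add, Matrix.mul_sub, Matrix.smul_mul, Matrix.mul_smul, smul_add]
  abel

lemma pdM_twistedD {f : (Fin n → ℝ) → Matrix (Fin m) (Fin r) ℂ}
    (hM : ∀ μ ν, DifferentiableAt ℝ (M μ ν) x) (hf : ∀ l, EntriesDiffAt (pdM l f) x)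
    (κ ν : Fin n) :
    pdM κ (twistedD M f ν) x
      = ∑ l, (pd κ (M l ν) x • pdM l f x + M l ν x • pdM κ (pdM l f) x) := by
  unfold twistedD
  rw [pdM_sum fun l _ => (hf l).smul (hM l ν)]
  exact Finset.sum_congr rfl fun l _ => pdM_smul (hM l ν) (hf l) κ

/-- The Frölicher–Nijenhuis bracket is the obstruction to anticommutativity of twisted
differentials. -/
lemma twistedD₁_twistedD_add {V : Set (Fin n → ℝ)} (hV : IsOpen V)
    (hN : ∀ μ ν, ContDiffOn ℝ ∞ (N μ ν) V) (hM : ∀ μ ν, ContDiffOn ℝ ∞ (M μ ν) V)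
    {f : (Fin n → ℝ) → Matrix (Fin m) (Fin r) ℂ} (hf : EntriesSmoothOn f V)
    (hx : x ∈ V) (μ ν : Fin n) :
    twistedD₁ N (twistedD M f) μ ν x + twistedD₁ M (twistedD N f) μ ν x
      = ∑ l, FNb N M l μ ν x • pdM l f x := by
  have hN' : ∀ μ ν, DifferentiableAt ℝ (N μ ν) x := fun μ ν =>
    ((hN μ ν).contDiffAt (hV.mem_nhds hx)).differentiableAt (by simp)
  have hM' : ∀ μ ν, DifferentiableAt ℝ (M μ ν) x := fun μ ν =>
    ((hM μ ν).contDiffAt (hV.mem_nhds hx)).differentiableAt (by simp)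
  have hf' : ∀ l, EntriesDiffAt (pdM l f) x := fun l => (hf.pdM hV l).entriesDiffAt hV hx
  have hsymm : ∀ a b : Fin n → ℝ,
      ∑ κ, ∑ l, (a κ * b l) • pdM κ (pdM l f) x = ∑ κ, ∑ l, (b κ * a l) • pdM κ (pdM l f) x := by
    intro a b
    rw [Finset.sum_comm]
    exact Finset.sum_congr rfl fun κ _ => Finset.sum_congr rfl fun l _ => by
      rw [pdM_comm hf hV hx, mul_comm]
  have hNM := hsymm (fun κ => N κ μ x) (fun κ => M κ ν x)
  have hMN := hsymm (fun κ => M κ μ x) (fun κ => N κ ν x)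
  have hexp : ∑ l, FNb N M l μ ν x • pdM l f x
      = ∑ κ, ∑ l, ((N κ μ x * pd κ (M l ν) x - N κ ν x * pd κ (M l μ) x
      + M κ μ x * pd κ (N l ν) x - M κ ν x * pd κ (N l μ) x
      + N l κ x * (pd ν (M κ μ) x - pd μ (M κ ν) x)
      + M l κ x * (pd ν (N κ μ) x - pd μ (N κ ν) x))) • pdM l f x := by
    simp only [FNb, Finset.sum_smul]
    exact Finset.sum_comm
  rw [hexp, ← sub_eq_zero]
  have hzero := congrArg₂ (· + ·) (sub_eq_zero.2 hNM) (sub_eq_zero.2 hMN)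
  simp only [add_zero] at hzero
  rw [← hzero]
  simp only [twistedD₁, pdM_twistedD hN' hf', pdM_twistedD hM' hf']
  simp only [twistedD, Finset.smul_sum, ← Finset.sum_add_distrib, ← Finset.sum_sub_distrib]
  refine Finset.sum_congr rfl fun κ _ => Finset.sum_congr rfl fun l _ => ?_
  module

/-- The nonlinear system in terms of the twisted differentials. -/
lemma phiPDE_iff {V : Set (Fin n → ℝ)} (hV : IsOpen V)
    (hN : ∀ μ ν, ContDiffOn ℝ ∞ (N μ ν) V)
    {φ : (Fin n → ℝ) → Matrix (Fin m) (Fin m) ℂ} (hφ : EntriesSmoothOn φ V)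
    (hx : x ∈ V) (μ ν : Fin n) :
    phiPDE N M φ μ ν x ↔ twistedD₁ M (twistedD N φ) μ ν x
      = twistedD N φ μ x * twistedD N φ ν x - twistedD N φ ν x * twistedD N φ μ x := by
  have hN' : ∀ μ ν, DifferentiableAt ℝ (N μ ν) x := fun μ ν =>
    ((hN μ ν).contDiffAt (hV.mem_nhds hx)).differentiableAt (by simp)
  have hφ' : ∀ l, EntriesDiffAt (pdM l φ) x := fun l => (hφ.pdM hV l).entriesDiffAt hV hx
  have hpd : ∀ κ ν, pdM κ (twistedD N φ ν) x
      = ∑ l, pdM κ (fun y => N l ν y • pdM l φ y) x := fun κ ν => by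
    unfold twistedD
    exact pdM_sum (fun l _ => (hφ' l).smul (hN' l ν)) κ
  have hl : (∑ κ, ∑ l, (M κ μ x • pdM κ (fun y => N l ν y • pdM l φ y) x
            - M κ ν x • pdM κ (fun y => N l μ y • pdM l φ y) x))
      + (∑ κ, ∑ l, (N κ l x * (pd ν (M l μ) x - pd μ (M l ν) x)) • pdM κ φ x)
      = twistedD₁ M (twistedD N φ) μ ν x := by
    rw [Finset.sum_comm (f := fun κ l =>
      (N κ l x * (pd ν (M l μ) x - pd μ (M l ν) x)) • pdM κ φ x)]
    simp only [twistedD₁, hpd]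
    simp only [twistedD, Finset.smul_sum, ← Finset.sum_add_distrib, ← Finset.sum_sub_distrib]
    refine Finset.sum_congr rfl fun κ _ => Finset.sum_congr rfl fun l _ => ?_
    module
  have hr : ∑ κ, ∑ l, (N κ μ x * N l ν x) • (pdM κ φ x * pdM l φ x - pdM l φ x * pdM κ φ x)
      = twistedD N φ μ x * twistedD N φ ν x - twistedD N φ ν x * twistedD N φ μ x := by
    simp only [twistedD, Finset.sum_mul_sum]
    rw [Finset.sum_comm (f := fun κ l => (N κ ν x • pdM κ φ x) * (N l μ x • pdM l φ x))]
    simp only [← Finset.sum_sub_distrib]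
    refine Finset.sum_congr rfl fun κ _ => Finset.sum_congr rfl fun l _ => ?_
    simp only [Matrix.smul_mul, Matrix.mul_smul]
    module
  rw [phiPDE, hl, hr]

end TwistedDifferentials

/-- The pointwise algebra behind the first-order equation satisfied by `θ Ω⁻¹ η`; primes denote
the first differential and the suffix `₂` the second one. -/
lemma darboux_algebra {A : Matrix (Fin m) (Fin m) ℂ} {P P' Q κ l Ω Ω' Ω₂ : Matrix (Fin r) (Fin r) ℂ}
    {θ' θ₂ Y Y' Y₂ : Matrix (Fin m) (Fin r) ℂ} {η η' η₂ : Matrix (Fin r) (Fin m) ℂ}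
    (hu : IsUnit Ω) (hθ' : θ' = Y' * Ω + Y * Ω') (hθ₂ : θ₂ = Y₂ * Ω + Y * Ω₂)
    (hS : P * Ω - Ω * Q = η * (Y * Ω))
    (hθ : θ₂ - θ' * Q = A * (Y * Ω) + Y * Ω * l)
    (hη : η₂ - P * η' = -(η * A) + κ * η)
    (hΩ : Ω₂ = Ω' * Q - P' * Ω + η' * (Y * Ω) + κ * Ω + Ω * l) :
    Y₂ * η + Y * η₂ = A * (Y * η) - (Y' * η + Y * η') * (Y * η) - Y * η * A
      + ((Y' * P + Y * P') * η + Y * P * η') := by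
  have hY : Y₂ = A * Y + Y' * P - Y' * η * Y + Y * P' - Y * η' * Y - Y * κ := by
    have hmul : Y₂ * Ω
        = (A * Y + Y' * P - Y' * η * Y + Y * P' - Y * η' * Y - Y * κ) * Ω := by
      have hS' : Ω * Q = P * Ω - η * (Y * Ω) := by rw [← hS]; abel
      have hθ₂' : Y₂ * Ω + Y * Ω₂ = A * (Y * Ω) + Y * Ω * l + (Y' * Ω + Y * Ω') * Q := by
        rw [← hθ₂, ← hθ', ← hθ]; abel
      rw [hΩ, ← eq_sub_iff_add_eq] at hθ₂'
      rw [hθ₂', Matrix.add_mul _ _ Q, Matrix.mul_assoc Y' Ω Q, hS']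
      simp only [Matrix.add_mul, Matrix.sub_mul, Matrix.mul_add, Matrix.mul_sub, Matrix.mul_assoc]
      abel
    have hdet := (Matrix.isUnit_iff_isUnit_det _).1 hu
    have := congrArg (· * Ω⁻¹) hmul
    simpa only [Matrix.mul_nonsing_inv_cancel_right _ _ hdet] using this
  rw [hY, show η₂ = -(η * A) + κ * η + P * η' by rw [← hη]; abel]
  simp only [Matrix.add_mul, Matrix.sub_mul, Matrix.mul_add, Matrix.mul_neg, Matrix.mul_assoc]
  abel

/-- If `u` satisfies the first-order equation `d₂u = [d₁φ, u] - d₁u u + d₁Z`, then `φ - u` solves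
the nonlinear system together with `φ`. -/
lemma phiPDE_sub {N₁ N₂ : Fin n → Fin n → (Fin n → ℝ) → ℝ} {V : Set (Fin n → ℝ)} (hV : IsOpen V)
    (hN₁ : ∀ μ ν, ContDiffOn ℝ ∞ (N₁ μ ν) V) (hN₂ : ∀ μ ν, ContDiffOn ℝ ∞ (N₂ μ ν) V)
    (hFN11 : ∀ x ∈ V, ∀ l μ ν, FNb N₁ N₁ l μ ν x = 0)
    (hFN12 : ∀ x ∈ V, ∀ l μ ν, FNb N₁ N₂ l μ ν x = 0)
    {φ u Z : (Fin n → ℝ) → Matrix (Fin m) (Fin m) ℂ}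
    (hφ : EntriesSmoothOn φ V) (hus : EntriesSmoothOn u V) (hZ : EntriesSmoothOn Z V)
    (hu : ∀ x ∈ V, ∀ μ, twistedD N₂ u μ x
      = twistedD N₁ φ μ x * u x - twistedD N₁ u μ x * u x - u x * twistedD N₁ φ μ x
        + twistedD N₁ Z μ x)
    {x : Fin n → ℝ} (hx : x ∈ V) {μ ν : Fin n} (hPDE : phiPDE N₁ N₂ φ μ ν x) :
    phiPDE N₁ N₂ (fun y => φ y - u y) μ ν x := by
  have hsq : ∀ {f : (Fin n → ℝ) → Matrix (Fin m) (Fin m) ℂ}, EntriesSmoothOn f V →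
      twistedD₁ N₁ (twistedD N₁ f) μ ν x = 0 := fun {f} hf => by
    have h := twistedD₁_twistedD_add hV hN₁ hN₁ hf hx μ ν
    simp only [hFN11 x hx, zero_smul, Finset.sum_const_zero] at h
    rw [← two_smul ℂ] at h
    exact (smul_eq_zero.1 h).resolve_left two_ne_zero
  have hanti : twistedD₁ N₁ (twistedD N₂ u) μ ν x + twistedD₁ N₂ (twistedD N₁ u) μ ν x = 0 := by
    rw [twistedD₁_twistedD_add hV hN₁ hN₂ hus hx μ ν]
    simp only [hFN12 x hx, zero_smul, Finset.sum_const_zero]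
  have dφ : ∀ μ, EntriesDiffAt (twistedD N₁ φ μ) x := fun μ =>
    (hφ.twistedD hN₁ hV μ).entriesDiffAt hV hx
  have du : ∀ μ, EntriesDiffAt (twistedD N₁ u μ) x := fun μ =>
    (hus.twistedD hN₁ hV μ).entriesDiffAt hV hx
  have dZ : ∀ μ, EntriesDiffAt (twistedD N₁ Z μ) x := fun μ =>
    (hZ.twistedD hN₁ hV μ).entriesDiffAt hV hx
  have u' := hus.entriesDiffAt hV hx
  have hdd : twistedD₁ N₁ (twistedD N₂ u) μ ν x
      = -(twistedD N₁ φ μ x * twistedD N₁ u ν x - twistedD N₁ φ ν x * twistedD N₁ u μ x)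
        + (twistedD N₁ u μ x * twistedD N₁ u ν x - twistedD N₁ u ν x * twistedD N₁ u μ x)
        - (twistedD N₁ u μ x * twistedD N₁ φ ν x - twistedD N₁ u ν x * twistedD N₁ φ μ x) := by
    rw [twistedD₁_congr (fun μ => Filter.eventuallyEq_of_mem (hV.mem_nhds hx)
        fun y hy => hu y hy μ),
      twistedD₁_add (fun μ => (((dφ μ).mul u').sub ((du μ).mul u')).sub (u'.mul (dφ μ))) dZ,
      twistedD₁_sub (fun μ => ((dφ μ).mul u').sub ((du μ).mul u')) (fun μ => u'.mul (dφ μ)),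
      twistedD₁_sub (fun μ => (dφ μ).mul u') (fun μ => (du μ).mul u'),
      twistedD₁_mul_right dφ u', twistedD₁_mul_right du u', twistedD₁_mul_left u' dφ]
    have h1 := hsq hφ
    have h2 := hsq hus
    have h3 := hsq hZ
    simp only [h1, h2, h3, Matrix.zero_mul, Matrix.mul_zero]
    abel
  rw [phiPDE_iff hV hN₁ hφ hx] at hPDE
  rw [phiPDE_iff hV hN₁ (hφ.sub hus) hx,
    twistedD₁_congr (fun μ => Filter.eventuallyEq_of_mem (hV.mem_nhds hx) fun y hy =>
      twistedD_sub (hφ.entriesDiffAt hV hy) (hus.entriesDiffAt hV hy) μ),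
    twistedD₁_sub dφ du, hPDE, eq_neg_of_add_eq_zero_right hanti, hdd]
  simp only [twistedD_sub (hφ.entriesDiffAt hV hx) u', Matrix.sub_mul, Matrix.mul_sub]
  abel

end BidifferentialCalculus

open BidifferentialCalculus in
/-- the binary Darboux transformation `φ' = φ − θ Ω⁻¹ η` produces a new
solution of the nonlinear PDE system. -/
theorem statement7 {n m r : ℕ} (U : Set (Fin n → ℝ)) (hU : IsOpen U)
    (N₁ N₂ : Fin n → Fin n → (Fin n → ℝ) → ℝ)
    (hN₁s : ∀ μ ν, ContDiffOn ℝ (⊤ : ℕ∞) (N₁ μ ν) U)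
    (hN₂s : ∀ μ ν, ContDiffOn ℝ (⊤ : ℕ∞) (N₂ μ ν) U)
    (hFN11 : ∀ x ∈ U, ∀ l μ ν, FNb N₁ N₁ l μ ν x = 0)
    (hFN12 : ∀ x ∈ U, ∀ l μ ν, FNb N₁ N₂ l μ ν x = 0)
    (hFN22 : ∀ x ∈ U, ∀ l μ ν, FNb N₂ N₂ l μ ν x = 0)
    (φ : (Fin n → ℝ) → Matrix (Fin m) (Fin m) ℂ)
    (hφs : ∀ i j, ContDiffOn ℝ (⊤ : ℕ∞) (fun y => φ y i j) U)
    (hφPDE : ∀ x ∈ U, ∀ μ ν, phiPDE N₁ N₂ φ μ ν x)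
    (A : Fin n → (Fin n → ℝ) → Matrix (Fin m) (Fin m) ℂ)
    (hAdef : A = fun μ x => ∑ κ, N₁ κ μ x • pdM κ φ x)
    (P Q : (Fin n → ℝ) → Matrix (Fin r) (Fin r) ℂ)
    (kap lam : Fin n → (Fin n → ℝ) → Matrix (Fin r) (Fin r) ℂ)
    (hPs : ∀ i j, ContDiffOn ℝ (⊤ : ℕ∞) (fun y => P y i j) U)
    (hQs : ∀ i j, ContDiffOn ℝ (⊤ : ℕ∞) (fun y => Q y i j) U)
    (hkaps : ∀ μ i j, ContDiffOn ℝ (⊤ : ℕ∞) (fun y => kap μ y i j) U)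
    (hlams : ∀ μ i j, ContDiffOn ℝ (⊤ : ℕ∞) (fun y => lam μ y i j) U)
    (hP : ∀ x ∈ U, ∀ μ, (∑ ν, N₂ ν μ x • pdM ν P x) - (kap μ x * P x - P x * kap μ x)
        = ∑ ν, N₁ ν μ x • (P x * pdM ν P x))
    (hQ : ∀ x ∈ U, ∀ μ, (∑ ν, N₂ ν μ x • pdM ν Q x) + (lam μ x * Q x - Q x * lam μ x)
        = ∑ ν, N₁ ν μ x • (pdM ν Q x * Q x))
    (hkap : ∀ x ∈ U, ∀ μ ν,
        (∑ κ, (N₂ κ μ x • pdM κ (kap ν) x - N₂ κ ν x • pdM κ (kap μ) x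
              + (pd ν (N₂ κ μ) x - pd μ (N₂ κ ν) x) • kap κ x))
          - (kap μ x * kap ν x - kap ν x * kap μ x)
        = P x * (∑ κ, (N₁ κ μ x • pdM κ (kap ν) x - N₁ κ ν x • pdM κ (kap μ) x
              + (pd ν (N₁ κ μ) x - pd μ (N₁ κ ν) x) • kap κ x)))
    (hlam : ∀ x ∈ U, ∀ μ ν,
        (∑ κ, (N₂ κ μ x • pdM κ (lam ν) x - N₂ κ ν x • pdM κ (lam μ) x
              + (pd ν (N₂ κ μ) x - pd μ (N₂ κ ν) x) • lam κ x))
          + (lam μ x * lam ν x - lam ν x * lam μ x)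
        = (∑ κ, (N₁ κ μ x • pdM κ (lam ν) x - N₁ κ ν x • pdM κ (lam μ) x
              + (pd ν (N₁ κ μ) x - pd μ (N₁ κ ν) x) • lam κ x)) * Q x)
    (θ : (Fin n → ℝ) → Matrix (Fin m) (Fin r) ℂ)
    (η : (Fin n → ℝ) → Matrix (Fin r) (Fin m) ℂ)
    (hθs : ∀ i j, ContDiffOn ℝ (⊤ : ℕ∞) (fun y => θ y i j) U)
    (hηs : ∀ i j, ContDiffOn ℝ (⊤ : ℕ∞) (fun y => η y i j) U)
    (hθ : ∀ x ∈ U, ∀ μ,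
        ∑ ν, pdM ν θ x * (N₂ ν μ x • (1 : Matrix (Fin r) (Fin r) ℂ) - N₁ ν μ x • Q x)
        = A μ x * θ x + θ x * lam μ x)
    (hη : ∀ x ∈ U, ∀ μ,
        ∑ ν, (N₂ ν μ x • (1 : Matrix (Fin r) (Fin r) ℂ) - N₁ ν μ x • P x) * pdM ν η x
        = -(η x * A μ x) + kap μ x * η x)
    (Ω : (Fin n → ℝ) → Matrix (Fin r) (Fin r) ℂ)
    (hΩs : ∀ i j, ContDiffOn ℝ (⊤ : ℕ∞) (fun y => Ω y i j) U)
    (hSylv : ∀ x ∈ U, P x * Ω x - Ω x * Q x = η x * θ x)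
    (hΩ : ∀ x ∈ U, ∀ μ, ∑ ν, N₂ ν μ x • pdM ν Ω x
        = (∑ ν, N₁ ν μ x • (pdM ν Ω x * Q x - pdM ν P x * Ω x + pdM ν η x * θ x))
          + kap μ x * Ω x + Ω x * lam μ x) :
    ∀ V : Set (Fin n → ℝ), IsOpen V → V ⊆ U → (∀ x ∈ V, IsUnit (Ω x)) →
      ∀ x ∈ V, ∀ μ ν,
        phiPDE N₁ N₂ (fun y => φ y - θ y * (Ω y)⁻¹ * η y) μ ν x := by
  intro V hV hVU hunit x hx μ ν
  have hN₁ : ∀ μ ν, ContDiffOn ℝ ∞ (N₁ μ ν) V := fun μ ν => (hN₁s μ ν).mono hVU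
  have hN₂ : ∀ μ ν, ContDiffOn ℝ ∞ (N₂ μ ν) V := fun μ ν => (hN₂s μ ν).mono hVU
  have sφ : EntriesSmoothOn φ V := fun i j => (hφs i j).mono hVU
  have sP : EntriesSmoothOn P V := fun i j => (hPs i j).mono hVU
  have sθ : EntriesSmoothOn θ V := fun i j => (hθs i j).mono hVU
  have sη : EntriesSmoothOn η V := fun i j => (hηs i j).mono hVU
  have sΩ : EntriesSmoothOn Ω V := fun i j => (hΩs i j).mono hVU
  have sY : EntriesSmoothOn (fun y => θ y * (Ω y)⁻¹) V := sθ.mul (sΩ.inv hunit)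
  have hYΩ : ∀ y ∈ V, θ y = θ y * (Ω y)⁻¹ * Ω y := fun y hy =>
    (Matrix.nonsing_inv_mul_cancel_right _ _
      ((Matrix.isUnit_iff_isUnit_det _).1 (hunit y hy))).symm
  refine phiPDE_sub hV hN₁ hN₂ (fun x hx => hFN11 x (hVU hx)) (fun x hx => hFN12 x (hVU hx))
    sφ (sY.mul sη) ((sY.mul sP).mul sη) (fun y hy μ => ?_) hx (hφPDE x (hVU hx) μ ν)
  have dP := sP.entriesDiffAt hV hy
  have dη := sη.entriesDiffAt hV hy
  have dΩ := sΩ.entriesDiffAt hV hy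
  have dY := sY.entriesDiffAt hV hy
  have hDθ : ∀ N : Fin n → Fin n → (Fin n → ℝ) → ℝ, twistedD N θ μ y
      = twistedD N (fun y => θ y * (Ω y)⁻¹) μ y * Ω y
        + θ y * (Ω y)⁻¹ * twistedD N Ω μ y := fun N => by
    rw [twistedD_congr (Filter.eventuallyEq_of_mem (hV.mem_nhds hy) hYΩ), twistedD_mul dY dΩ]
  rw [twistedD_mul dY dη, twistedD_mul dY dη, twistedD_mul (dY.mul dP) dη, twistedD_mul dY dP]
  refine darboux_algebra (Q := Q y) (κ := kap μ y) (l := lam μ y) (hunit y hy)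
    (hDθ N₁) (hDθ N₂) ?_ ?_ ?_ ?_
  · rw [← hYΩ y hy]
    exact hSylv y (hVU hy)
  · have h := hθ y (hVU hy) μ
    rw [← hYΩ y hy]
    simp only [hAdef] at h
    simpa only [twistedD, Matrix.mul_sub, Matrix.mul_smul, Matrix.mul_one, Finset.sum_sub_distrib,
      Matrix.sum_mul, Matrix.smul_mul] using h
  · have h := hη y (hVU hy) μ
    simp only [hAdef] at h
    simpa only [twistedD, Matrix.sub_mul, Matrix.smul_mul, Matrix.one_mul, Finset.sum_sub_distrib,
      Matrix.mul_sum, Matrix.mul_smul] using h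
  · have h := hΩ y (hVU hy) μ
    rw [← hYΩ y hy]
    simpa only [twistedD, smul_add, smul_sub, Finset.sum_add_distrib, Finset.sum_sub_distrib,
      Matrix.sum_mul, Matrix.smul_mul] using h
end

section
/- Binary Darboux transformation in complex coordinates. Let U ⊆ ℂ be open and symmetric about the real axis and h : U → ℂ holomorphic. Write ∂_z := (1/2)(∂₁ − i∂₂) and ∂_z̄ := (1/2)(∂₁ + i∂₂) for the Wirtinger derivatives and h* for the pointwise complex conjugate of h. Let P, Q, κ_z, κ_z̄, λ_z, λ_z̄ : U → M_r(ℂ) be smooth with P−hI, P−h*I, Q−hI, Q−h*I invertible everywhere, satisfying: (P−hI)∂_zP = −[κ_z,P]; (P−h*I)∂_z̄P = −[κ_z̄,P]; ∂_zQ·(Q−hI) = [λ_z,Q]; ∂_z̄Q·(Q−h*I) = [λ_z̄,Q]; (P−h*I)∂_z̄κ_z − (P−hI)∂_zκ_z̄ − [κ_z,κ_z̄] = 0; ∂_z̄λ_z·(Q−h*I) − ∂_zλ_z̄·(Q−hI) + [λ_z,λ_z̄] = 0. Let φ : U → M_m(ℂ) be a smooth solution of Im(h)·∂_z∂_z̄φ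 = −(i/2)[∂_zφ, ∂_z̄φ], and set A_z := ∂_zφ, A_z̄ := ∂_z̄φ. Let θ : U → M_{m×r}(ℂ) and η : U → M_{r×m}(ℂ) be smooth solutions of ∂_zθ·(Q−hI) = −θλ_z − A_zθ; ∂_z̄θ·(Q−h*I) = −θλ_z̄ − A_z̄θ; (P−hI)∂_zη = −κ_zη + ηA_z; (P−h*I)∂_z̄η = −κ_z̄η + ηA_z̄. Let Ω : U → M_r(ℂ) be a smooth solution of PΩ − ΩQ = ηθ; ∂_zΩ·(Q−hI) = ∂_zP·Ω − ∂_zη·θ − κ_zΩ − Ωλ_z; ∂_z̄Ω·(Q−h*I) = ∂_z̄P·Ω − ∂_z̄η·θ − κ_z̄Ω − Ωλ_z̄. If Ω is invertible on U, then φ' := φ − θΩ^{-1}η also solves Im(h)·∂_z∂_z̄φ' = −(i/2)[∂_zφ', ∂_z̄φ']. -/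
open scoped BigOperators

/-- Real directional derivative of a matrix-valued function on `ℂ`, entrywise,
in the direction `v : ℂ`. -/
noncomputable def pdc {m r : ℕ} (v : ℂ) (f : ℂ → Matrix (Fin m) (Fin r) ℂ) (x : ℂ) :
    Matrix (Fin m) (Fin r) ℂ :=
  Matrix.of fun i j => fderiv ℝ (fun y => f y i j) x v

/-- Wirtinger derivative `∂_z = (1/2)(∂₁ − i ∂₂)`. -/
noncomputable def pdz {m r : ℕ} (f : ℂ → Matrix (Fin m) (Fin r) ℂ) (x : ℂ) :
    Matrix (Fin m) (Fin r) ℂ :=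
  (2⁻¹ : ℂ) • (pdc 1 f x - Complex.I • pdc Complex.I f x)

/-- Wirtinger derivative `∂_z̄ = (1/2)(∂₁ + i ∂₂)`. -/
noncomputable def pdzb {m r : ℕ} (f : ℂ → Matrix (Fin m) (Fin r) ℂ) (x : ℂ) :
    Matrix (Fin m) (Fin r) ℂ :=
  (2⁻¹ : ℂ) • (pdc 1 f x + Complex.I • pdc Complex.I f x)

/-- The first-order operator `(1/2)(∂₁ + c ∂₂)`, acting entrywise on matrix-valued functions;
`c = -i` and `c = i` give the Wirtinger derivatives. -/
noncomputable def wirtinger {m r : ℕ} (c : ℂ) (f : ℂ → Matrix (Fin m) (Fin r) ℂ) (x : ℂ) :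
    Matrix (Fin m) (Fin r) ℂ :=
  (2⁻¹ : ℂ) • (pdc 1 f x + c • pdc Complex.I f x)

/-- Entrywise real differentiability of a matrix-valued function at a point. -/
def EntrywiseDiffAt {m r : ℕ} (f : ℂ → Matrix (Fin m) (Fin r) ℂ) (x : ℂ) : Prop :=
  ∀ i j, DifferentiableAt ℝ (fun y => f y i j) x

lemma pdz_eq_wirtinger {m r : ℕ} (f : ℂ → Matrix (Fin m) (Fin r) ℂ) :
    pdz f = wirtinger (-Complex.I) f := by
  funext x
  simp [pdz, wirtinger, sub_eq_add_neg]

lemma pdzb_eq_wirtinger {m r : ℕ} (f : ℂ → Matrix (Fin m) (Fin r) ℂ) :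
    pdzb f = wirtinger Complex.I f := rfl

section calculus

variable {l m n : ℕ} {x : ℂ}

lemma pdc_mul {v : ℂ} {f : ℂ → Matrix (Fin l) (Fin m) ℂ} {g : ℂ → Matrix (Fin m) (Fin n) ℂ}
    (hf : EntrywiseDiffAt f x) (hg : EntrywiseDiffAt g x) :
    pdc v (fun y => f y * g y) x = pdc v f x * g x + f x * pdc v g x := by
  ext i j
  simp only [pdc, Matrix.of_apply, Matrix.mul_apply, Matrix.add_apply]
  rw [fderiv_fun_sum fun k _ => (hf i k).fun_mul (hg k j)]
  simp only [_root_.sum_apply, ← Finset.sum_add_distrib]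
  refine Finset.sum_congr rfl fun k _ => ?_
  rw [fderiv_fun_mul (hf i k) (hg k j)]
  simp
  ring

lemma pdc_sub {v : ℂ} {f g : ℂ → Matrix (Fin m) (Fin n) ℂ}
    (hf : EntrywiseDiffAt f x) (hg : EntrywiseDiffAt g x) :
    pdc v (fun y => f y - g y) x = pdc v f x - pdc v g x := by
  ext i j
  simp only [pdc, Matrix.of_apply, Matrix.sub_apply]
  rw [fderiv_fun_sub (hf i j) (hg i j)]
  simp

lemma pdc_add {v : ℂ} {f g : ℂ → Matrix (Fin m) (Fin n) ℂ}
    (hf : EntrywiseDiffAt f x) (hg : EntrywiseDiffAt g x) :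
    pdc v (fun y => f y + g y) x = pdc v f x + pdc v g x := by
  ext i j
  simp only [pdc, Matrix.of_apply, Matrix.add_apply]
  rw [fderiv_fun_add (hf i j) (hg i j)]
  simp

lemma pdc_const {v : ℂ} (M : Matrix (Fin m) (Fin n) ℂ) : pdc v (fun _ => M) x = 0 := by
  ext i j
  simp [pdc]

lemma pdc_congr {v : ℂ} {f g : ℂ → Matrix (Fin m) (Fin n) ℂ}
    (hfg : f =ᶠ[nhds x] g) : pdc v f x = pdc v g x := by
  ext i j
  simp only [pdc, Matrix.of_apply]
  rw [Filter.EventuallyEq.fderiv_eq]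
  filter_upwards [hfg] with y hy
  rw [hy]

variable {c : ℂ}

lemma wirtinger_mul {f : ℂ → Matrix (Fin l) (Fin m) ℂ} {g : ℂ → Matrix (Fin m) (Fin n) ℂ}
    (hf : EntrywiseDiffAt f x) (hg : EntrywiseDiffAt g x) :
    wirtinger c (fun y => f y * g y) x = wirtinger c f x * g x + f x * wirtinger c g x := by
  simp only [wirtinger, pdc_mul hf hg, Matrix.smul_mul, Matrix.mul_smul, Matrix.add_mul,
    Matrix.mul_add, smul_add]
  abel

lemma wirtinger_sub {f g : ℂ → Matrix (Fin m) (Fin n) ℂ}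
    (hf : EntrywiseDiffAt f x) (hg : EntrywiseDiffAt g x) :
    wirtinger c (fun y => f y - g y) x = wirtinger c f x - wirtinger c g x := by
  simp only [wirtinger, pdc_sub hf hg, smul_add, smul_sub]
  abel

lemma wirtinger_add {f g : ℂ → Matrix (Fin m) (Fin n) ℂ}
    (hf : EntrywiseDiffAt f x) (hg : EntrywiseDiffAt g x) :
    wirtinger c (fun y => f y + g y) x = wirtinger c f x + wirtinger c g x := by
  simp only [wirtinger, pdc_add hf hg, smul_add]
  abel

lemma wirtinger_const (M : Matrix (Fin m) (Fin n) ℂ) : wirtinger c (fun _ => M) x = 0 := by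
  simp [wirtinger, pdc_const]

lemma wirtinger_congr {f g : ℂ → Matrix (Fin m) (Fin n) ℂ}
    (hfg : f =ᶠ[nhds x] g) : wirtinger c f x = wirtinger c g x := by
  simp [wirtinger, pdc_congr hfg]

lemma EntrywiseDiffAt.mul {f : ℂ → Matrix (Fin l) (Fin m) ℂ} {g : ℂ → Matrix (Fin m) (Fin n) ℂ}
    (hf : EntrywiseDiffAt f x) (hg : EntrywiseDiffAt g x) :
    EntrywiseDiffAt (fun y => f y * g y) x := by
  intro i j
  simp only [Matrix.mul_apply]
  exact DifferentiableAt.fun_sum fun k _ => (hf i k).mul (hg k j)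

lemma EntrywiseDiffAt.sub {f g : ℂ → Matrix (Fin m) (Fin n) ℂ}
    (hf : EntrywiseDiffAt f x) (hg : EntrywiseDiffAt g x) :
    EntrywiseDiffAt (fun y => f y - g y) x :=
  fun i j => (hf i j).sub (hg i j)

lemma EntrywiseDiffAt.add {f g : ℂ → Matrix (Fin m) (Fin n) ℂ}
    (hf : EntrywiseDiffAt f x) (hg : EntrywiseDiffAt g x) :
    EntrywiseDiffAt (fun y => f y + g y) x :=
  fun i j => (hf i j).add (hg i j)

lemma entrywiseDiffAt_const (M : Matrix (Fin m) (Fin n) ℂ) :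
    EntrywiseDiffAt (fun _ => M) x :=
  fun _ _ => differentiableAt_const _

lemma entrywiseDiffAt_smul_one {a : ℂ → ℂ} (ha : DifferentiableAt ℝ a x) :
    EntrywiseDiffAt (fun y => a y • (1 : Matrix (Fin n) (Fin n) ℂ)) x := by
  intro i j
  simp only [Matrix.smul_apply, smul_eq_mul]
  exact ha.mul_const _

lemma EntrywiseDiffAt.det {f : ℂ → Matrix (Fin n) (Fin n) ℂ} (hf : EntrywiseDiffAt f x) :
    DifferentiableAt ℝ (fun y => (f y).det) x := by
  simp only [Matrix.det_apply]
  exact DifferentiableAt.fun_sum fun σ _ =>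
    (HasFDerivAt.finsetProd fun i _ =>
      (hf (σ i) i).hasFDerivAt).differentiableAt.const_smul (Equiv.Perm.sign σ)

lemma EntrywiseDiffAt.inv {f : ℂ → Matrix (Fin n) (Fin n) ℂ} (hf : EntrywiseDiffAt f x)
    (hu : IsUnit (f x)) : EntrywiseDiffAt (fun y => (f y)⁻¹) x := by
  intro i j
  have hdet : (f x).det ≠ 0 := ((Matrix.isUnit_iff_isUnit_det _).1 hu).ne_zero
  simp only [Matrix.inv_def, Ring.inverse_eq_inv', Matrix.smul_apply, smul_eq_mul,
    Matrix.adjugate_apply]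
  refine (hf.det.inv hdet).mul (EntrywiseDiffAt.det fun k k' => ?_)
  simp only [Matrix.updateRow_apply]
  split_ifs
  · exact differentiableAt_const _
  · exact hf k k'

lemma wirtinger_inv {f : ℂ → Matrix (Fin n) (Fin n) ℂ} (hf : EntrywiseDiffAt f x)
    (hu : IsUnit (f x)) :
    wirtinger c (fun y => (f y)⁻¹) x = -((f x)⁻¹ * wirtinger c f x * (f x)⁻¹) := by
  have hdx := (Matrix.isUnit_iff_isUnit_det _).1 hu
  have hev : (fun y => f y * (f y)⁻¹) =ᶠ[nhds x] fun _ => 1 := by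
    filter_upwards [hf.det.continuousAt.eventually_ne hdx.ne_zero] with y hy
    exact Matrix.mul_nonsing_inv _ (isUnit_iff_ne_zero.2 hy)
  have key := wirtinger_congr (c := c) hev
  rw [wirtinger_const, wirtinger_mul hf (hf.inv hu)] at key
  have := congrArg (fun M => (f x)⁻¹ * M) key
  simp only [Matrix.mul_add, Matrix.mul_zero, Matrix.nonsing_inv_mul_cancel_left _ _ hdx] at this
  rw [Matrix.mul_assoc]
  exact eq_neg_of_add_eq_zero_right this

lemma wirtinger_conj_smul_one {h : ℂ → ℂ} (hh : DifferentiableAt ℂ h x) :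
    wirtinger (-Complex.I)
      (fun y => (starRingEnd ℂ) (h y) • (1 : Matrix (Fin n) (Fin n) ℂ)) x = 0 := by
  rw [← pdz_eq_wirtinger]
  have hd : HasFDerivAt (fun y => (starRingEnd ℂ) (h y))
      (Complex.conjCLE.toContinuousLinearMap ∘L
        ((fderiv ℂ h x).restrictScalars ℝ)) x :=
    Complex.conjCLE.toContinuousLinearMap.hasFDerivAt.comp x
      (hh.hasFDerivAt.restrictScalars ℝ)
  have hI : fderiv ℂ h x Complex.I = Complex.I * fderiv ℂ h x 1 := by
    rw [← smul_eq_mul, ← map_smul, smul_eq_mul, mul_one]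
  ext i j
  have he := (hd.mul_const ((1 : Matrix (Fin n) (Fin n) ℂ) i j)).fderiv
  simp only [pdz, pdc, Matrix.smul_apply, smul_eq_mul, Matrix.sub_apply, Matrix.of_apply, he,
    Matrix.zero_apply]
  simp [hI]
  linear_combination (starRingEnd ℂ) (deriv h x) *
    (1 : Matrix (Fin n) (Fin n) ℂ) i j * Complex.I_sq

lemma entrywiseDiffAt_wirtinger {U : Set ℂ} (hU : IsOpen U) (hx : x ∈ U)
    {f : ℂ → Matrix (Fin m) (Fin n) ℂ}
    (hf : ∀ i j, ContDiffOn ℝ (⊤ : ℕ∞) (fun y => f y i j) U) :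
    EntrywiseDiffAt (wirtinger c f) x := by
  intro i j
  have hd : DifferentiableAt ℝ (fderiv ℝ fun y => f y i j) x :=
    (((hf i j).fderiv_of_isOpen (m := 1) hU (by norm_cast)).contDiffAt
      (hU.mem_nhds hx)).differentiableAt (by norm_num)
  have hv (v : ℂ) : DifferentiableAt ℝ (fun y => fderiv ℝ (fun y => f y i j) y v) x :=
    hd.clm_apply (differentiableAt_const v)
  simpa [wirtinger, pdc] using ((hv 1).add ((hv Complex.I).const_mul c)).const_mul (2⁻¹ : ℂ)

end calculus

section algebra

variable {R : Type*} [CommRing R] {m r : ℕ}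
  {θ θ' : Matrix (Fin m) (Fin r) R} {η η' : Matrix (Fin r) (Fin m) R}
  {A : Matrix (Fin m) (Fin m) R} {Ω Ω' P' Q' κ lam p q : Matrix (Fin r) (Fin r) R}

lemma eq_mul_nonsing_inv {M N : Matrix (Fin m) (Fin r) R} (hq : IsUnit q) (h : M * q = N) :
    M = N * q⁻¹ := by
  rw [← h, Matrix.mul_nonsing_inv_cancel_right _ _ ((Matrix.isUnit_iff_isUnit_det _).1 hq)]

lemma eq_nonsing_inv_mul {M N : Matrix (Fin r) (Fin m) R} (hp : IsUnit p) (h : p * M = N) :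
    M = p⁻¹ * N := by
  rw [← h, Matrix.nonsing_inv_mul_cancel_left _ _ ((Matrix.isUnit_iff_isUnit_det _).1 hp)]

/-- Under the Sylvester equation, `1 + θ q⁻¹ Ω⁻¹ η` has left inverse `1 - θ Ω⁻¹ p⁻¹ η`. -/
lemma darboux_gauge_cancel (hp : IsUnit p) (hq : IsUnit q) (hΩ : IsUnit Ω)
    (hS : p * Ω - Ω * q = η * θ) :
    (1 - θ * Ω⁻¹ * p⁻¹ * η) * (1 + θ * q⁻¹ * Ω⁻¹ * η) = 1 := by
  rw [Matrix.isUnit_iff_isUnit_det] at hp hq hΩ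
  have key : Ω⁻¹ * p⁻¹ * (η * θ) * q⁻¹ * Ω⁻¹ = q⁻¹ * Ω⁻¹ - Ω⁻¹ * p⁻¹ := by
    rw [← hS]
    simp [Matrix.mul_sub, Matrix.sub_mul, Matrix.mul_assoc, hp, hq, hΩ]
  have key' := congrArg (fun M => θ * M * η) key
  simp only [Matrix.mul_sub, Matrix.sub_mul, Matrix.mul_assoc] at key'
  simp only [Matrix.mul_add, Matrix.sub_mul, Matrix.mul_assoc, Matrix.mul_one, Matrix.one_mul,
    key']
  abel

lemma darboux_potential_deriv (hp : IsUnit p) (hq : IsUnit q)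
    (hS : p * Ω - Ω * q = η * θ) (hP : p * P' = -(κ * p - p * κ))
    (hη : p * η' = -(κ * η) + η * A)
    (hΩ' : Ω' * q = P' * Ω - η' * θ - κ * Ω - Ω * lam) :
    Ω' = -(p⁻¹ * κ * Ω) - p⁻¹ * η * A * θ * q⁻¹ - Ω * lam * q⁻¹ := by
  rw [eq_mul_nonsing_inv hq hΩ', eq_nonsing_inv_mul hp hP, eq_nonsing_inv_mul hp hη]
  rw [Matrix.isUnit_iff_isUnit_det] at hp hq
  have hS' := congrArg (fun M => p⁻¹ * κ * M * q⁻¹) hS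
  simp only [Matrix.mul_sub, Matrix.sub_mul, Matrix.mul_assoc, Matrix.mul_nonsing_inv _ hq,
    Matrix.mul_one] at hS'
  simp only [Matrix.mul_sub, Matrix.sub_mul, Matrix.mul_add, Matrix.add_mul, Matrix.mul_neg,
    Matrix.neg_mul, Matrix.mul_assoc, Matrix.nonsing_inv_mul_cancel_left _ _ hp, ← hS']
  abel

/-- The Darboux transformation acts on `A = ∂φ` as a gauge transformation. -/
lemma darboux_deriv_eq (hp : IsUnit p) (hq : IsUnit q) (hΩ : IsUnit Ω)
    (hS : p * Ω - Ω * q = η * θ) (hP : p * P' = -(κ * p - p * κ))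
    (hθ : θ' * q = -(θ * lam) - A * θ) (hη : p * η' = -(κ * η) + η * A)
    (hΩ' : Ω' * q = P' * Ω - η' * θ - κ * Ω - Ω * lam) :
    A - (θ' * Ω⁻¹ * η + θ * -(Ω⁻¹ * Ω' * Ω⁻¹) * η + θ * Ω⁻¹ * η')
      = (1 + θ * q⁻¹ * Ω⁻¹ * η)⁻¹ * A * (1 + θ * q⁻¹ * Ω⁻¹ * η) := by
  rw [Matrix.inv_eq_left_inv (darboux_gauge_cancel hp hq hΩ hS),
    darboux_potential_deriv hp hq hS hP hη hΩ', eq_mul_nonsing_inv hq hθ,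
    eq_nonsing_inv_mul hp hη]
  rw [Matrix.isUnit_iff_isUnit_det] at hΩ
  simp only [Matrix.mul_sub, Matrix.sub_mul, Matrix.mul_add, Matrix.mul_neg,
    Matrix.neg_mul, Matrix.mul_assoc, Matrix.nonsing_inv_mul_cancel_left _ _ hΩ,
    Matrix.mul_nonsing_inv_cancel_left _ _ hΩ, Matrix.mul_one, Matrix.one_mul]
  abel

/-- The gauge matrix with parameter `b` solves the linear system in the direction with
parameter `a`; here `δ = a - b`, `p = P - a`, `q = Q - a`. -/
lemma darboux_gauge_deriv {qb : Matrix (Fin r) (Fin r) R} {δ : R} (hqb : qb = q + δ • 1)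
    (hp : IsUnit p) (hq : IsUnit q) (hqbu : IsUnit qb) (hΩ : IsUnit Ω)
    (hS : p * Ω - Ω * q = η * θ) (hP : p * P' = -(κ * p - p * κ))
    (hQ : Q' * q = lam * q - q * lam)
    (hθ : θ' * q = -(θ * lam) - A * θ) (hη : p * η' = -(κ * η) + η * A)
    (hΩ' : Ω' * q = P' * Ω - η' * θ - κ * Ω - Ω * lam) :
    δ • (θ' * qb⁻¹ * Ω⁻¹ * η + θ * -(qb⁻¹ * Q' * qb⁻¹) * Ω⁻¹ * η
        + θ * qb⁻¹ * -(Ω⁻¹ * Ω' * Ω⁻¹) * η + θ * qb⁻¹ * Ω⁻¹ * η')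
      = A * (1 + θ * qb⁻¹ * Ω⁻¹ * η) - (1 + θ * qb⁻¹ * Ω⁻¹ * η) *
        ((1 + θ * q⁻¹ * Ω⁻¹ * η)⁻¹ * A * (1 + θ * q⁻¹ * Ω⁻¹ * η)) := by
  have hS' : (p + δ • 1) * Ω - Ω * qb = η * θ := by
    rw [← hS, hqb]
    simp only [Matrix.add_mul, Matrix.mul_add, Matrix.smul_mul, Matrix.mul_smul, Matrix.one_mul,
      Matrix.mul_one]
    abel
  rw [Matrix.inv_eq_left_inv (darboux_gauge_cancel hp hq hΩ hS),
    darboux_potential_deriv hp hq hS hP hη hΩ', eq_mul_nonsing_inv hq hθ,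
    eq_nonsing_inv_mul hp hη]
  rw [Matrix.isUnit_iff_isUnit_det] at hp hq hqbu hΩ
  -- the partial fraction identity for `q⁻¹ qb⁻¹`
  have hres : δ • (q⁻¹ * qb⁻¹) = q⁻¹ - qb⁻¹ := by
    have h1 : q⁻¹ * (q + δ • 1) * qb⁻¹ = q⁻¹ := by
      rw [← hqb, Matrix.mul_nonsing_inv_cancel_right _ _ hqbu]
    rw [Matrix.mul_add, Matrix.add_mul, Matrix.nonsing_inv_mul _ hq, Matrix.one_mul,
      Matrix.mul_smul, Matrix.mul_one, Matrix.smul_mul] at h1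
    exact eq_sub_of_add_eq' h1
  have hQ' : qb⁻¹ * Q' * qb⁻¹ = qb⁻¹ * lam * q⁻¹ - lam * q⁻¹ * qb⁻¹ := by
    have hcomm : q⁻¹ * qb⁻¹ = qb⁻¹ * q⁻¹ := by
      rw [← Matrix.mul_inv_rev, ← Matrix.mul_inv_rev, hqb]
      simp [Matrix.add_mul, Matrix.mul_add]
    have hQb : Q' * q = lam * qb - qb * lam := by
      rw [hQ, hqb]
      simp [Matrix.add_mul, Matrix.mul_add]
    rw [eq_mul_nonsing_inv ((Matrix.isUnit_iff_isUnit_det _).2 hq) hQb]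
    simp only [Matrix.mul_sub, Matrix.sub_mul, Matrix.mul_assoc, hcomm,
      Matrix.nonsing_inv_mul_cancel_left _ _ hqbu, Matrix.mul_nonsing_inv_cancel_left _ _ hqbu]
  -- the product of the gauge matrix with the inverse gauge matrix
  have hmix : δ • (θ * qb⁻¹ * Ω⁻¹ * p⁻¹ * η)
      = 1 - (1 + θ * qb⁻¹ * Ω⁻¹ * η) * (1 - θ * Ω⁻¹ * p⁻¹ * η) := by
    have key : qb⁻¹ * Ω⁻¹ * (η * θ) * Ω⁻¹ * p⁻¹
        = qb⁻¹ * Ω⁻¹ + δ • (qb⁻¹ * Ω⁻¹ * p⁻¹) - Ω⁻¹ * p⁻¹ := by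
      rw [← hS']
      simp [Matrix.mul_sub, Matrix.sub_mul, Matrix.mul_add, Matrix.add_mul, Matrix.mul_assoc,
        hp, hqbu, hΩ]
    have key' := congrArg (fun M => θ * M * η) key
    simp only [Matrix.mul_sub, Matrix.sub_mul, Matrix.mul_add, Matrix.add_mul, Matrix.mul_assoc,
      Matrix.smul_mul, Matrix.mul_smul] at key'
    simp only [Matrix.mul_sub, Matrix.add_mul, Matrix.mul_assoc, Matrix.mul_one, Matrix.one_mul,
      key']
    abel
  rw [hQ']
  calc
    _ = -(A * θ * (δ • (q⁻¹ * qb⁻¹)) * Ω⁻¹ * η)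
        + δ • (θ * qb⁻¹ * Ω⁻¹ * p⁻¹ * η) * (A * (1 + θ * q⁻¹ * Ω⁻¹ * η)) := by
      simp only [Matrix.mul_sub, Matrix.sub_mul, Matrix.mul_add, Matrix.mul_neg,
        Matrix.neg_mul, Matrix.mul_assoc, Matrix.nonsing_inv_mul_cancel_left _ _ hΩ,
        Matrix.mul_nonsing_inv_cancel_left _ _ hΩ, Matrix.mul_one,
        Matrix.smul_mul, Matrix.mul_smul, ← smul_neg, ← smul_add]
      congr 1
      abel
    _ = _ := by
      rw [hres, hmix]
      simp only [Matrix.mul_sub, Matrix.sub_mul, Matrix.mul_add, Matrix.add_mul,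
        Matrix.mul_assoc, Matrix.mul_one, Matrix.one_mul]
      abel

end algebra

/-- If `(a - b) ∂G = A G - G (K⁻¹ A K)`, then gauging by `G` and `K` is compatible with the
equation `(a - b) ∂B = [A, B]`. -/
lemma gauge_commutator {R : Type*} [CommRing R] {m : ℕ} {δ : R}
    {A A' B B' G G' : Matrix (Fin m) (Fin m) R} (hG : IsUnit G)
    (hB : δ • B' = A * B - B * A) (hG' : δ • G' = A * G - G * A') :
    δ • ((-(G⁻¹ * G' * G⁻¹) * B + G⁻¹ * B') * G + G⁻¹ * B * G')
      = A' * (G⁻¹ * B * G) - G⁻¹ * B * G * A' := by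
  rw [Matrix.isUnit_iff_isUnit_det] at hG
  calc
    _ = (-(G⁻¹ * (δ • G') * G⁻¹) * B + G⁻¹ * (δ • B')) * G + G⁻¹ * B * (δ • G') := by
      simp only [Matrix.smul_mul, Matrix.mul_smul, smul_add, smul_neg, Matrix.add_mul,
        Matrix.neg_mul]
    _ = _ := by
      rw [hB, hG']
      simp only [Matrix.mul_sub, Matrix.sub_mul, Matrix.add_mul, Matrix.neg_mul,
        Matrix.mul_assoc, Matrix.nonsing_inv_mul_cancel_left _ _ hG,
        Matrix.mul_nonsing_inv_cancel_left _ _ hG]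
      abel

lemma sub_smul_one_sylvester {R : Type*} [CommRing R] {m r : ℕ} {P Q Ω : Matrix (Fin r) (Fin r) R}
    {θ : Matrix (Fin m) (Fin r) R} {η : Matrix (Fin r) (Fin m) R} (a : R)
    (hS : P * Ω - Ω * Q = η * θ) : (P - a • 1) * Ω - Ω * (Q - a • 1) = η * θ := by
  rw [← hS]
  simp [Matrix.sub_mul, Matrix.mul_sub]

lemma commutator_sub_smul_one {R : Type*} [CommRing R] {r : ℕ} (K P : Matrix (Fin r) (Fin r) R)
    (a : R) : K * (P - a • 1) - (P - a • 1) * K = K * P - P * K := by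
  simp [Matrix.sub_mul, Matrix.mul_sub]

lemma im_smul_eq_neg_I_div_two_smul_iff {m : ℕ} {a : ℂ} {M N : Matrix (Fin m) (Fin m) ℂ} :
    a.im • M = (-(Complex.I / 2)) • N ↔ (a - (starRingEnd ℂ) a) • M = N := by
  have h2 : (-(Complex.I / 2)) ≠ 0 := by simp
  have him : a.im • M = (-(Complex.I / 2)) • (a - (starRingEnd ℂ) a) • M := by
    rw [smul_smul, Complex.sub_conj, ← Complex.coe_smul]
    congr 1
    push_cast
    linear_combination (a.im : ℂ) * Complex.I_sq
  rw [him, smul_right_inj h2]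

/-- The Darboux-transformed field has first derivatives gauge equivalent to those of `φ`. -/
lemma wirtinger_darboux {m r : ℕ} {c a x : ℂ}
    {φ : ℂ → Matrix (Fin m) (Fin m) ℂ} {θ : ℂ → Matrix (Fin m) (Fin r) ℂ}
    {η : ℂ → Matrix (Fin r) (Fin m) ℂ} {P Q Ω : ℂ → Matrix (Fin r) (Fin r) ℂ}
    {κ lam : Matrix (Fin r) (Fin r) ℂ}
    (hφd : EntrywiseDiffAt φ x) (hθd : EntrywiseDiffAt θ x) (hηd : EntrywiseDiffAt η x)
    (hΩd : EntrywiseDiffAt Ω x)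
    (hp : IsUnit (P x - a • (1 : Matrix (Fin r) (Fin r) ℂ)))
    (hq : IsUnit (Q x - a • (1 : Matrix (Fin r) (Fin r) ℂ))) (hΩ : IsUnit (Ω x))
    (hS : P x * Ω x - Ω x * Q x = η x * θ x)
    (hP : (P x - a • 1) * wirtinger c P x = -(κ * P x - P x * κ))
    (hθ : wirtinger c θ x * (Q x - a • 1) = -(θ x * lam) - wirtinger c φ x * θ x)
    (hη : (P x - a • 1) * wirtinger c η x = -(κ * η x) + η x * wirtinger c φ x)
    (hΩ' : wirtinger c Ω x * (Q x - a • 1)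
      = wirtinger c P x * Ω x - wirtinger c η x * θ x - κ * Ω x - Ω x * lam) :
    wirtinger c (fun y => φ y - θ y * (Ω y)⁻¹ * η y) x
      = (1 + θ x * (Q x - a • 1)⁻¹ * (Ω x)⁻¹ * η x)⁻¹ * wirtinger c φ x
        * (1 + θ x * (Q x - a • 1)⁻¹ * (Ω x)⁻¹ * η x) := by
  rw [← darboux_deriv_eq hp hq hΩ (sub_smul_one_sylvester a hS)
      (by rw [hP, commutator_sub_smul_one]) hθ hη hΩ',
    wirtinger_sub hφd ((hθd.mul (hΩd.inv hΩ)).mul hηd),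
    wirtinger_mul (hθd.mul (hΩd.inv hΩ)) hηd, wirtinger_mul hθd (hΩd.inv hΩ),
    wirtinger_inv hΩd hΩ, Matrix.add_mul]

/-- binary Darboux transformation in complex coordinates for
`Im(h)·φ_{z z̄} = −(i/2)[φ_z, φ_z̄]`. -/
theorem statement11 {m r : ℕ} (U : Set ℂ) (hU : IsOpen U)
    (hUsym : ∀ z ∈ U, (starRingEnd ℂ) z ∈ U)
    (h : ℂ → ℂ) (hh : DifferentiableOn ℂ h U)
    (P Q kapz kapzb lamz lamzb : ℂ → Matrix (Fin r) (Fin r) ℂ)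
    (hPs : ∀ i j, ContDiffOn ℝ (⊤ : ℕ∞) (fun y => P y i j) U)
    (hQs : ∀ i j, ContDiffOn ℝ (⊤ : ℕ∞) (fun y => Q y i j) U)
    (hkapzs : ∀ i j, ContDiffOn ℝ (⊤ : ℕ∞) (fun y => kapz y i j) U)
    (hkapzbs : ∀ i j, ContDiffOn ℝ (⊤ : ℕ∞) (fun y => kapzb y i j) U)
    (hlamzs : ∀ i j, ContDiffOn ℝ (⊤ : ℕ∞) (fun y => lamz y i j) U)
    (hlamzbs : ∀ i j, ContDiffOn ℝ (⊤ : ℕ∞) (fun y => lamzb y i j) U)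
    (hPinv1 : ∀ x ∈ U, IsUnit (P x - h x • (1 : Matrix (Fin r) (Fin r) ℂ)))
    (hPinv2 : ∀ x ∈ U, IsUnit (P x - (starRingEnd ℂ) (h x) • (1 : Matrix (Fin r) (Fin r) ℂ)))
    (hQinv1 : ∀ x ∈ U, IsUnit (Q x - h x • (1 : Matrix (Fin r) (Fin r) ℂ)))
    (hQinv2 : ∀ x ∈ U, IsUnit (Q x - (starRingEnd ℂ) (h x) • (1 : Matrix (Fin r) (Fin r) ℂ)))
    (hP1 : ∀ x ∈ U, (P x - h x • 1) * pdz P x = -(kapz x * P x - P x * kapz x))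
    (hP2 : ∀ x ∈ U, (P x - (starRingEnd ℂ) (h x) • 1) * pdzb P x
        = -(kapzb x * P x - P x * kapzb x))
    (hQ1 : ∀ x ∈ U, pdz Q x * (Q x - h x • 1) = lamz x * Q x - Q x * lamz x)
    (hQ2 : ∀ x ∈ U, pdzb Q x * (Q x - (starRingEnd ℂ) (h x) • 1)
        = lamzb x * Q x - Q x * lamzb x)
    (hkap : ∀ x ∈ U, (P x - (starRingEnd ℂ) (h x) • 1) * pdzb kapz x
          - (P x - h x • 1) * pdz kapzb x
          - (kapz x * kapzb x - kapzb x * kapz x) = 0)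
    (hlam : ∀ x ∈ U, pdzb lamz x * (Q x - (starRingEnd ℂ) (h x) • 1)
          - pdz lamzb x * (Q x - h x • 1)
          + (lamz x * lamzb x - lamzb x * lamz x) = 0)
    (φ : ℂ → Matrix (Fin m) (Fin m) ℂ)
    (hφs : ∀ i j, ContDiffOn ℝ (⊤ : ℕ∞) (fun y => φ y i j) U)
    (hφ : ∀ x ∈ U, (h x).im • pdz (pdzb φ) x
        = (-(Complex.I / 2)) • (pdz φ x * pdzb φ x - pdzb φ x * pdz φ x))
    (θ : ℂ → Matrix (Fin m) (Fin r) ℂ) (η : ℂ → Matrix (Fin r) (Fin m) ℂ)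
    (hθs : ∀ i j, ContDiffOn ℝ (⊤ : ℕ∞) (fun y => θ y i j) U)
    (hηs : ∀ i j, ContDiffOn ℝ (⊤ : ℕ∞) (fun y => η y i j) U)
    (hθ1 : ∀ x ∈ U, pdz θ x * (Q x - h x • 1) = -(θ x * lamz x) - pdz φ x * θ x)
    (hθ2 : ∀ x ∈ U, pdzb θ x * (Q x - (starRingEnd ℂ) (h x) • 1)
        = -(θ x * lamzb x) - pdzb φ x * θ x)
    (hη1 : ∀ x ∈ U, (P x - h x • 1) * pdz η x = -(kapz x * η x) + η x * pdz φ x)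
    (hη2 : ∀ x ∈ U, (P x - (starRingEnd ℂ) (h x) • 1) * pdzb η x
        = -(kapzb x * η x) + η x * pdzb φ x)
    (Ω : ℂ → Matrix (Fin r) (Fin r) ℂ)
    (hΩs : ∀ i j, ContDiffOn ℝ (⊤ : ℕ∞) (fun y => Ω y i j) U)
    (hSylv : ∀ x ∈ U, P x * Ω x - Ω x * Q x = η x * θ x)
    (hΩ1 : ∀ x ∈ U, pdz Ω x * (Q x - h x • 1)
        = pdz P x * Ω x - pdz η x * θ x - kapz x * Ω x - Ω x * lamz x)
    (hΩ2 : ∀ x ∈ U, pdzb Ω x * (Q x - (starRingEnd ℂ) (h x) • 1)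
        = pdzb P x * Ω x - pdzb η x * θ x - kapzb x * Ω x - Ω x * lamzb x)
    (hΩinv : ∀ x ∈ U, IsUnit (Ω x)) :
    ∀ x ∈ U,
      (h x).im • pdz (pdzb (fun y => φ y - θ y * (Ω y)⁻¹ * η y)) x
        = (-(Complex.I / 2)) •
            (pdz (fun y => φ y - θ y * (Ω y)⁻¹ * η y) x
              * pdzb (fun y => φ y - θ y * (Ω y)⁻¹ * η y) x
            - pdzb (fun y => φ y - θ y * (Ω y)⁻¹ * η y) x
              * pdz (fun y => φ y - θ y * (Ω y)⁻¹ * η y) x) := by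
  intro x hx
  have hdiff {k l : ℕ} {f : ℂ → Matrix (Fin k) (Fin l) ℂ}
      (hf : ∀ i j, ContDiffOn ℝ (⊤ : ℕ∞) (fun y => f y i j) U) {y : ℂ} (hy : y ∈ U) :
      EntrywiseDiffAt f y := fun i j =>
    ((hf i j).contDiffAt (hU.mem_nhds hy)).differentiableAt (by simp)
  have hhx : DifferentiableAt ℂ h x := hh.differentiableAt (hU.mem_nhds hx)
  have hφx := im_smul_eq_neg_I_div_two_smul_iff.1 (hφ x hx)
  rw [im_smul_eq_neg_I_div_two_smul_iff]
  simp only [pdz_eq_wirtinger, pdzb_eq_wirtinger] at *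
  have hA := wirtinger_darboux (hdiff hφs hx) (hdiff hθs hx) (hdiff hηs hx) (hdiff hΩs hx)
    (hPinv1 x hx) (hQinv1 x hx) (hΩinv x hx) (hSylv x hx) (hP1 x hx) (hθ1 x hx) (hη1 x hx)
    (hΩ1 x hx)
  have hB (y : ℂ) (hy : y ∈ U) := wirtinger_darboux (hdiff hφs hy) (hdiff hθs hy) (hdiff hηs hy)
    (hdiff hΩs hy) (hPinv2 y hy) (hQinv2 y hy) (hΩinv y hy) (hSylv y hy) (hP2 y hy) (hθ2 y hy)
    (hη2 y hy) (hΩ2 y hy)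
  rw [hA, hB x hx, wirtinger_congr (Filter.eventuallyEq_of_mem (hU.mem_nhds hx) hB)]
  have hbd := entrywiseDiffAt_smul_one (n := r) (a := fun y => (starRingEnd ℂ) (h y))
    (Complex.conjCLE.differentiableAt.comp x (hhx.restrictScalars ℝ))
  have hqbd : EntrywiseDiffAt (fun y => Q y - (starRingEnd ℂ) (h y) • 1) x :=
    (hdiff hQs hx).sub hbd
  have hqb' : wirtinger (-Complex.I) (fun y => Q y - (starRingEnd ℂ) (h y) • 1) x
      = wirtinger (-Complex.I) Q x := by
    rw [wirtinger_sub (hdiff hQs hx) hbd, wirtinger_conj_smul_one hhx, sub_zero]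
  have hu1 := hqbd.inv (hQinv2 x hx)
  have hu2 := (hdiff hθs hx).mul hu1
  have hu3 := (hdiff hΩs hx).inv (hΩinv x hx)
  have hu4 := hu2.mul hu3
  have hu5 := hu4.mul (hdiff hηs hx)
  have hGd := (entrywiseDiffAt_const (x := x) (1 : Matrix (Fin m) (Fin m) ℂ)).add hu5
  have hG : IsUnit (1 + θ x * (Q x - (starRingEnd ℂ) (h x) • 1)⁻¹ * (Ω x)⁻¹ * η x) :=
    IsUnit.of_mul_eq_one_right _ (darboux_gauge_cancel (hPinv2 x hx) (hQinv2 x hx) (hΩinv x hx)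
      (sub_smul_one_sylvester _ (hSylv x hx)))
  have hBd := entrywiseDiffAt_wirtinger (c := Complex.I) hU hx hφs
  rw [wirtinger_mul ((hGd.inv hG).mul hBd) hGd, wirtinger_mul (hGd.inv hG) hBd,
    wirtinger_inv hGd hG]
  refine gauge_commutator hG hφx ?_
  rw [wirtinger_add (entrywiseDiffAt_const _) hu5, wirtinger_const, zero_add,
    wirtinger_mul hu4 (hdiff hηs hx), wirtinger_mul hu2 hu3, wirtinger_mul (hdiff hθs hx) hu1,
    wirtinger_inv (hdiff hΩs hx) (hΩinv x hx), wirtinger_inv hqbd (hQinv2 x hx), hqb',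
    Matrix.add_mul, Matrix.add_mul, Matrix.add_mul]
  refine darboux_gauge_deriv ?_ (hPinv1 x hx) (hQinv1 x hx) (hQinv2 x hx) (hΩinv x hx)
    (sub_smul_one_sylvester _ (hSylv x hx)) (by rw [hP1 x hx, commutator_sub_smul_one])
    (by rw [hQ1 x hx, commutator_sub_smul_one]) (hθ1 x hx) (hη1 x hx) (hΩ1 x hx)
  rw [sub_smul]
  abel
end

section
/- Let U ⊆ ℝⁿ be open and f₁,…,f_n : U → ℝ smooth functions such that f_μ(x) ≠ f_ν(x) for all x ∈ U whenever μ ≠ ν. Define N^μ_ν := f_ν·δ^μ_ν (a pointwise diagonal matrix of functions). Then the coordinate Nijenhuis torsion of N vanishes identically on U if and only if ∂_μ f_ν = 0 on U for all μ ≠ ν, i.e., each f_ν depends only on the single coordinate x^ν. -/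
open scoped BigOperators

theorem pd_ite_zero {n : ℕ} (μ : Fin n) (c : Prop) [Decidable c] (g : (Fin n → ℝ) → ℝ)
    (x : Fin n → ℝ) : pd μ (if c then g else 0) x = if c then pd μ g x else 0 := by
  split_ifs <;> simp [pd]

/-- The Nijenhuis torsion of a pointwise diagonal tensor. -/
theorem nijenhuis_torsion_diagonal {n : ℕ} (f : Fin n → (Fin n → ℝ) → ℝ)
    (N : Fin n → Fin n → (Fin n → ℝ) → ℝ) (hN : N = fun μ ν => if μ = ν then f ν else 0)
    (x : Fin n → ℝ) (l μ ν : Fin n) :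
    ∑ κ, (N κ μ x * pd κ (N l ν) x - N κ ν x * pd κ (N l μ) x
        + N l κ x * (pd ν (N κ μ) x - pd μ (N κ ν) x)) =
      (f μ x - f ν x) *
        ((if l = ν then pd μ (f ν) x else 0) + if l = μ then pd ν (f μ) x else 0) := by
  subst hN
  have ite_apply_zero (c : Prop) [Decidable c] (g : (Fin n → ℝ) → ℝ) :
      (if c then g else 0) x = if c then g x else 0 := by
    split_ifs <;> rfl
  simp only [pd_ite_zero, ite_apply_zero, Finset.sum_add_distrib, Finset.sum_sub_distrib, ite_mul,
    zero_mul, Finset.sum_ite_eq, Finset.sum_ite_eq', Finset.mem_univ, if_true]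
  split_ifs <;> subst_vars <;> ring

/-- for a pointwise diagonal `N^μ_ν = f_ν δ^μ_ν` with pairwise distinct
eigenvalue functions, the coordinate Nijenhuis torsion vanishes on `U` iff each `f_ν`
depends only on the coordinate `x^ν` (i.e. `∂_μ f_ν = 0` for `μ ≠ ν`). -/
theorem statement16 {n : ℕ} (U : Set (Fin n → ℝ)) (hU : IsOpen U)
    (f : Fin n → (Fin n → ℝ) → ℝ)
    (hf : ∀ μ, ContDiffOn ℝ (⊤ : ℕ∞) (f μ) U)
    (hdist : ∀ x ∈ U, ∀ μ ν, μ ≠ ν → f μ x ≠ f ν x)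
    (N : Fin n → Fin n → (Fin n → ℝ) → ℝ)
    (hN : N = fun μ ν => if μ = ν then f ν else 0) :
    (∀ x ∈ U, ∀ l μ ν,
        ∑ κ, (N κ μ x * pd κ (N l ν) x - N κ ν x * pd κ (N l μ) x
          + N l κ x * (pd ν (N κ μ) x - pd μ (N κ ν) x)) = 0)
      ↔ (∀ x ∈ U, ∀ μ ν, μ ≠ ν → pd μ (f ν) x = 0) := by
  simp only [nijenhuis_torsion_diagonal f N hN]
  constructor
  · intro h x hx μ ν hμν
    have key := h x hx ν μ ν
    simpa [hμν.symm, sub_ne_zero.mpr (hdist x hx μ ν hμν)] using key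
  · intro h x hx l μ ν
    by_cases hμν : μ = ν
    · simp [hμν]
    · simp [h x hx μ ν hμν, h x hx ν μ (Ne.symm hμν)]
end

section
/- Let U ⊆ ℝ⁴ be open and a₁, b₁, a₂, b₂ : U → ℝ smooth. Define the 4×4 matrix of functions N as block-diagonal with upper-left 2×2 block ((a₁, −b₁), (b₁, a₁)) (acting on coordinates x¹, x²) and lower-right 2×2 block ((a₂, −b₂), (b₂, a₂)) (acting on coordinates x³, x⁴). Suppose the Cauchy–Riemann equations ∂₁a₁ = ∂₂b₁, ∂₂a₁ = −∂₁b₁, ∂₃a₂ = ∂₄b₂, ∂₄a₂ = −∂₃b₂ hold, together with the eight coupling conditions: (a₂−a₁)∂₃a₁ + b₂∂₄a₁ + b₁∂₃b₁ = 0; (a₂−a₁)∂₄a₁ − b₂∂₃a₁ + b₁∂₄b₁ = 0; (a₂−a₁)∂₃b₁ − b₁∂₃a₁ + b₂∂₄b₁ = 0; (a₂−a₁)∂₄b₁ − b₁∂₄a₁ − b₂∂₃b₁ = 0; (a₂−a₁)∂₁a₂ − b₁∂₂a₂ − b₂∂₁b₂ = 0; (a₂−a₁)∂₁b₂ − b₁∂₂b₂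 + b₂∂₁a₂ = 0; (a₂−a₁)∂₂a₂ + b₁∂₁a₂ − b₂∂₂b₂ = 0; (a₂−a₁)∂₂b₂ + b₁∂₁b₂ + b₂∂₂a₂ = 0. Then the coordinate Nijenhuis torsion of N vanishes identically on U. -/
open scoped BigOperators

theorem pd_zero {n : ℕ} (μ : Fin n) (x : Fin n → ℝ) :
    pd μ (0 : (Fin n → ℝ) → ℝ) x = 0 := by
  simp [pd]

/-- the block-diagonal 4×4 tensor built from two 2×2 blocks
`((aᵢ, −bᵢ), (bᵢ, aᵢ))` has vanishing coordinate Nijenhuis torsion, provided the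
Cauchy–Riemann equations and the eight coupling conditions hold. -/
theorem statement18 (U : Set (Fin 4 → ℝ)) (hU : IsOpen U)
    (a₁ b₁ a₂ b₂ : (Fin 4 → ℝ) → ℝ)
    (ha₁ : ContDiffOn ℝ (⊤ : ℕ∞) a₁ U) (hb₁ : ContDiffOn ℝ (⊤ : ℕ∞) b₁ U)
    (ha₂ : ContDiffOn ℝ (⊤ : ℕ∞) a₂ U) (hb₂ : ContDiffOn ℝ (⊤ : ℕ∞) b₂ U)
    (N : Fin 4 → Fin 4 → (Fin 4 → ℝ) → ℝ)
    (hN : N = ![![a₁, -b₁, 0, 0], ![b₁, a₁, 0, 0], ![0, 0, a₂, -b₂], ![0, 0, b₂, a₂]])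
    (hCR1 : ∀ x ∈ U, pd 0 a₁ x = pd 1 b₁ x) (hCR2 : ∀ x ∈ U, pd 1 a₁ x = -(pd 0 b₁ x))
    (hCR3 : ∀ x ∈ U, pd 2 a₂ x = pd 3 b₂ x) (hCR4 : ∀ x ∈ U, pd 3 a₂ x = -(pd 2 b₂ x))
    (hc1 : ∀ x ∈ U, (a₂ x - a₁ x) * pd 2 a₁ x + b₂ x * pd 3 a₁ x + b₁ x * pd 2 b₁ x = 0)
    (hc2 : ∀ x ∈ U, (a₂ x - a₁ x) * pd 3 a₁ x - b₂ x * pd 2 a₁ x + b₁ x * pd 3 b₁ x = 0)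
    (hc3 : ∀ x ∈ U, (a₂ x - a₁ x) * pd 2 b₁ x - b₁ x * pd 2 a₁ x + b₂ x * pd 3 b₁ x = 0)
    (hc4 : ∀ x ∈ U, (a₂ x - a₁ x) * pd 3 b₁ x - b₁ x * pd 3 a₁ x - b₂ x * pd 2 b₁ x = 0)
    (hc5 : ∀ x ∈ U, (a₂ x - a₁ x) * pd 0 a₂ x - b₁ x * pd 1 a₂ x - b₂ x * pd 0 b₂ x = 0)
    (hc6 : ∀ x ∈ U, (a₂ x - a₁ x) * pd 0 b₂ x - b₁ x * pd 1 b₂ x + b₂ x * pd 0 a₂ x = 0)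
    (hc7 : ∀ x ∈ U, (a₂ x - a₁ x) * pd 1 a₂ x + b₁ x * pd 0 a₂ x - b₂ x * pd 1 b₂ x = 0)
    (hc8 : ∀ x ∈ U, (a₂ x - a₁ x) * pd 1 b₂ x + b₁ x * pd 0 b₂ x + b₂ x * pd 1 a₂ x = 0) :
    ∀ x ∈ U, ∀ l μ ν : Fin 4,
      ∑ κ, (N κ μ x * pd κ (N l ν) x - N κ ν x * pd κ (N l μ) x
        + N l κ x * (pd ν (N κ μ) x - pd μ (N κ ν) x)) = 0 := by
  intro x hx
  have CR1 := hCR1 x hx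
  have CR2 := hCR2 x hx
  have CR3 := hCR3 x hx
  have CR4 := hCR4 x hx
  have c1 := hc1 x hx
  have c2 := hc2 x hx
  have c3 := hc3 x hx
  have c4 := hc4 x hx
  have c5 := hc5 x hx
  have c6 := hc6 x hx
  have c7 := hc7 x hx
  have c8 := hc8 x hx
  subst hN
  intro l μ ν
  fin_cases l <;> fin_cases μ <;> fin_cases ν <;>
    simp [Fin.sum_univ_four, pd_neg, pd_zero, CR1, CR2, CR3, CR4] <;>
    linarith only [c1, c2, c3, c4, c5, c6, c7, c8]
end
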